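/- arXiv:2302.13171 — 2 statements merged into one kernel-verified Lean document; each statement's English description precedes it below -/
import Mathlib

section
/- (Usuba's characterization, one direction) If for every regular λ ≥ κ there is a δ-complete uniform ultrafilter over λ, and κ is δ-strongly compact in the ultrafilter sense, these are equivalent: κ is δ-strongly compact if and only if every regular λ ≥ κ carries a δ-complete uniform ultrafilter. -/
universe u

/-- `U` is `δ`-complete: it is closed under intersections of fewer than `δ` many sets. -/
def UFComplete {α : Type u} (δ : Cardinal.{u}) (U : Ultrafilter α) : Prop :=
  ∀ s : Set (Set α), Cardinal.mk s < δ → (∀ t ∈ s, t ∈ U) → ⋂₀ s ∈ U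

/-- `U` is uniform: every member of `U` has full cardinality. -/
def UFUniform {α : Type u} (U : Ultrafilter α) : Prop :=
  ∀ A ∈ U, Cardinal.mk A = Cardinal.mk α

/-- There is a `δ`-complete fine ultrafilter on `P_κ(θ)`; this is the ultrafilter form of
`(δ, θ)`-strong compactness of `κ` (an elementary `j : V → M` with `crit j ≥ δ` and a cover
`D ∈ M` of `j '' θ` with `|D| < j κ` in `M`). -/
def DeltaThetaCompact (δ κ θ : Cardinal.{u}) : Prop :=
  ∃ U : Ultrafilter {s : Set θ.out // Cardinal.mk s < κ},
    UFComplete δ U ∧ ∀ x : θ.out, {s : {s : Set θ.out // Cardinal.mk s < κ} | x ∈ s.1} ∈ U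

/-- `κ` is `δ`-strongly compact: it is `(δ, θ)`-strongly compact for every `θ ≥ κ`. -/
def IsDeltaStronglyCompact (δ κ : Cardinal.{u}) : Prop :=
  ∀ θ : Cardinal.{u}, κ ≤ θ → DeltaThetaCompact δ κ θ

namespace UsubaAux

open Cardinal Set

theorem mem_bind_iff {α β : Type u} (U : Ultrafilter α) (W : α → Ultrafilter β) (s : Set β) :
    s ∈ U.bind W ↔ {a | s ∈ W a} ∈ U := Iff.rfl

theorem complete_iff {α : Type u} {δ : Cardinal.{u}} {U : Ultrafilter α} (h : UFComplete δ U)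
    {ι : Type u} (hι : #ι < δ) (f : ι → Set α) (hf : ∀ i, f i ∈ U) : {a | ∀ i, a ∈ f i} ∈ U := by
  have h1 := h (range f) (mk_range_le.trans_lt hι) (by rintro _ ⟨i, rfl⟩; exact hf i)
  refine Filter.mem_of_superset h1 ?_
  intro a ha i
  exact ha _ ⟨i, rfl⟩

theorem complete_nat {α : Type u} {δ : Cardinal.{u}} (hδ : ℵ₀ < δ) {U : Ultrafilter α}
    (h : UFComplete δ U)
    (f : ℕ → Set α) (hf : ∀ i, f i ∈ U) : {a | ∀ i, a ∈ f i} ∈ U := by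
  have h1 := complete_iff h (ι := ULift.{u} ℕ) (by simpa using hδ) (fun i => f i.down)
    (fun i => hf _)
  refine Filter.mem_of_superset h1 ?_
  intro a ha i
  exact ha ⟨i⟩

theorem complete_map {α β : Type u} {δ : Cardinal.{u}} {U : Ultrafilter α} (h : UFComplete δ U)
    (f : α → β) : UFComplete δ (U.map f) := by
  intro s hs hst
  have h1 := complete_iff h hs (fun t : s => f ⁻¹' t.1) (fun t => hst t.1 t.2)
  rw [Ultrafilter.mem_map]
  refine Filter.mem_of_superset h1 ?_
  intro a ha t ht
  exact ha ⟨t, ht⟩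

theorem complete_pure {α : Type u} {δ : Cardinal.{u}} (a : α) :
    UFComplete δ (pure a : Ultrafilter α) := by
  intro s _ hst
  rw [Ultrafilter.mem_pure]
  intro t ht
  exact Ultrafilter.mem_pure.1 (hst t ht)

theorem complete_bind {α β : Type u} {δ : Cardinal.{u}} {U : Ultrafilter α} (h : UFComplete δ U)
    {W : α → Ultrafilter β} (hW : ∀ a, UFComplete δ (W a)) : UFComplete δ (U.bind W) := by
  intro s hs hst
  have h1 := complete_iff h hs (fun t : s => {a | t.1 ∈ W a}) (fun t => hst t.1 t.2)
  rw [mem_bind_iff]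
  refine Filter.mem_of_superset h1 ?_
  intro a ha
  exact hW a s hs (fun t ht => ha ⟨t, ht⟩)

theorem bind_assoc' {α β γ : Type u} (U : Ultrafilter α) (W : α → Ultrafilter β)
    (X : β → Ultrafilter γ) : (U.bind W).bind X = U.bind (fun a => (W a).bind X) := by
  ext s
  exact Iff.rfl

/-- The Ketonen order. -/
def KRel {A : Type u} [LinearOrder A] (δ : Cardinal.{u}) (D U : Ultrafilter A) : Prop :=
  UFComplete δ U ∧ ∃ W : A → Ultrafilter A, (∀ a, UFComplete δ (W a)) ∧
    {a | Iio a ∈ W a} ∈ U ∧ D = U.bind W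

theorem chain_step {A : Type u} [LinearOrder A] {δ : Cardinal.{u}} (hδ : ℵ₀ < δ)
    (U : ℕ → Ultrafilter A) (hU : ∀ n, KRel δ (U (n + 1)) (U n)) :
    {a | ∃ V : ℕ → Ultrafilter A, (∀ n, KRel δ (V (n + 1)) (V n)) ∧ Iio a ∈ V 0} ∈ U 0 := by
  choose hc W hW hS hUn using hU
  let V : A → ℕ → Ultrafilter A := fun a n => Nat.rec (W 0 a) (fun n v => v.bind (W (n + 1))) n
  have hV0 : ∀ a, V a 0 = W 0 a := fun a => rfl
  have hVs : ∀ a n, V a (n + 1) = (V a n).bind (W (n + 1)) := fun a n => rfl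
  have hVc : ∀ a n, UFComplete δ (V a n) := by
    intro a n
    induction n with
    | zero => exact hW 0 a
    | succ n ih => rw [hVs]; exact complete_bind ih (hW _)
  have hUV : ∀ n, U (n + 1) = (U 0).bind (fun a => V a n) := by
    intro n
    induction n with
    | zero => exact hUn 0
    | succ n ih =>
      rw [hUn (n + 1), ih, bind_assoc']
  have h1 : ∀ n, {a | {b | Iio b ∈ W (n + 1) b} ∈ V a n} ∈ U 0 := by
    intro n
    have := hS (n + 1)
    rw [hUV n] at this
    exact this
  have h2 := complete_nat hδ (hc 0) _ h1
  filter_upwards [h2, hS 0] with a ha hb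
  exact ⟨V a, fun n => ⟨hVc a n, W (n + 1), hW _, ha n, hVs a n⟩, hb⟩

theorem no_chain {A : Type u} [LinearOrder A] [WellFoundedLT A] {δ : Cardinal.{u}} (hδ : ℵ₀ < δ)
    (γ : A) : ¬ ∃ U : ℕ → Ultrafilter A, (∀ n, KRel δ (U (n + 1)) (U n)) ∧ Iio γ ∈ U 0 := by
  induction γ using WellFoundedLT.induction with
  | ind γ ih =>
    rintro ⟨U, hU, hγ⟩
    obtain ⟨a, ha, hb⟩ := (U 0).nonempty_of_mem (Filter.inter_mem (chain_step hδ U hU) hγ)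
    exact ih a hb ha

theorem wf_KRel {A : Type u} [LinearOrder A] [WellFoundedLT A] {δ : Cardinal.{u}} (hδ : ℵ₀ < δ) :
    WellFounded (KRel (A := A) δ) := by
  rw [wellFounded_iff_isEmpty_descending_chain]
  refine ⟨fun ⟨U, hU⟩ => ?_⟩
  obtain ⟨a, ha⟩ := (U 0).nonempty_of_mem (chain_step hδ U hU)
  exact no_chain hδ a ha

/-- Subsets of size less than the cofinality have strict upper bounds. -/
theorem exists_bound {B : Type u} [LinearOrder B] (s : Set B) (hs : #s < Order.cof B) :
    ∃ b, ∀ x ∈ s, x < b := by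
  by_contra! h
  exact absurd (Order.cof_le (s := s) h) hs.not_ge

theorem exists_tail {δ κ : Cardinal.{u}} (hκ : ℵ₀ ≤ κ)
    (H : ∀ lam : Cardinal.{u}, κ ≤ lam → lam.IsRegular →
        ∃ U : Ultrafilter lam.out, UFComplete δ U ∧ UFUniform U)
    {B : Type u} [LinearOrder B] [WellFoundedLT B] (hB : κ ≤ Order.cof B) :
    ∃ W : Ultrafilter B, UFComplete δ W ∧ ∀ b, Ioi b ∈ W := by
  have hreg : (Order.cof B).IsRegular := ⟨hκ.trans hB, (Order.cof_ord_cof B).ge⟩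
  obtain ⟨U, hU, hUu⟩ := H _ hB hreg
  obtain ⟨s, hs, hst⟩ := Ordinal.exists_ord_cof_eq B
  have hcard : #s = Order.cof B := by
    have := congrArg Ordinal.card hst
    simpa using this
  obtain ⟨e⟩ : Nonempty ((Order.cof B).out ≃ s) := by
    rw [← Cardinal.eq, hcard, mk_out]
  refine ⟨U.map (fun x => (e x).1), complete_map hU _, fun b => ?_⟩
  obtain ⟨c, hc, hbc⟩ := hs b
  by_contra hn
  rw [← Ultrafilter.compl_mem_iff_notMem] at hn
  have h1 := hUu _ hn
  rw [mk_out] at h1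
  have h2 : #(Iic (⟨c, hc⟩ : s)) < #s := by
    rw [← Iio_insert]
    refine (mk_insert_le).trans_lt ?_
    refine add_lt_of_lt (by rw [hcard]; exact hreg.aleph0_le) ?_ ?_
    · exact mk_Iio_lt _ (by rw [hcard]; exact hst.symm)
    · rw [hcard]; exact one_lt_aleph0.trans_le hreg.aleph0_le
  rw [hcard, ← h1] at h2
  refine h2.not_ge ?_
  refine mk_le_of_injective (f := fun x => ⟨e x.1, ?_⟩) ?_
  · have : ¬ (b < (e x.1).1) := x.2
    exact (not_lt.1 this).trans hbc
  · intro x y hxy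
    simpa [Subtype.ext_iff] using hxy

/-- The main construction: a fine family of small sets. -/
theorem exists_fine {δ κ : Cardinal.{u}} (hδ : ℵ₀ < δ) (hκ : ℵ₀ ≤ κ)
    (H : ∀ lam : Cardinal.{u}, κ ≤ lam → lam.IsRegular →
        ∃ U : Ultrafilter lam.out, UFComplete δ U ∧ UFUniform U)
    {A : Type u} [LinearOrder A] [WellFoundedLT A] (hA : κ ≤ Order.cof A)
    (hI : ∀ a : A, #(Iio a) < Order.cof A) :
    ∃ U : Ultrafilter A, UFComplete δ U ∧ ∃ S : A → Set A, (∀ a, #(S a) < κ) ∧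
      ∀ x, {a | x ∈ S a} ∈ U := by
  classical
  obtain ⟨U, ⟨hU, hUt⟩, hmin⟩ := (wf_KRel (A := A) hδ).has_min
    {W | UFComplete δ W ∧ ∀ b, Ioi b ∈ W} (exists_tail hκ H hA)
  -- minimality
  have key : ∀ W : A → Ultrafilter A, (∀ a, UFComplete δ (W a)) → {a | Iio a ∈ W a} ∈ U →
      ¬ ∀ b, {a | Ioi b ∈ W a} ∈ U := by
    intro W hW hWI hb
    exact hmin (U.bind W) ⟨complete_bind hU hW, hb⟩ ⟨hU, W, hW, hWI, rfl⟩
  -- weak normality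
  have wn : ∀ f : A → A, {a | f a < a} ∈ U → ∃ γ, {a | f a ≤ γ} ∈ U := by
    intro f hf
    by_contra! hn
    refine key (fun a => pure (f a)) (fun a => complete_pure _) ?_ ?_
    · filter_upwards [hf] with a ha
      exact Ultrafilter.mem_pure.2 ha
    · intro b
      have := Ultrafilter.compl_mem_iff_notMem.2 (hn b)
      filter_upwards [this] with a ha
      exact Ultrafilter.mem_pure.2 (not_le.1 ha)
  -- small cofinality
  have hsmall : {a : A | Order.cof (Iio a) < κ} ∈ U := by
    by_contra hn
    rw [← Ultrafilter.compl_mem_iff_notMem] at hn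
    have : ∀ a : A, ∃ W : Ultrafilter A, UFComplete δ W ∧
        (κ ≤ Order.cof (Iio a) → Iio a ∈ W ∧ ∀ b < a, Ioi b ∈ W) := by
      intro a
      by_cases ha : κ ≤ Order.cof (Iio a)
      · obtain ⟨W, hW, hWt⟩ := exists_tail hκ H ha
        refine ⟨W.map Subtype.val, complete_map hW _, fun _ => ⟨?_, fun b hb => ?_⟩⟩
        · rw [Ultrafilter.mem_map]
          exact Filter.mem_of_superset Filter.univ_mem (fun x _ => x.2)
        · rw [Ultrafilter.mem_map]
          exact Filter.mem_of_superset (hWt ⟨b, hb⟩) (fun x hx => hx)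
      · exact ⟨pure a, complete_pure a, fun h => absurd h ha⟩
    choose W hW hW2 using this
    refine key W hW ?_ ?_
    · filter_upwards [hn] with a ha
      exact (hW2 a (not_lt.1 ha)).1
    · intro b
      filter_upwards [hn, hUt b] with a ha hb
      exact (hW2 a (not_lt.1 ha)).2 b hb
  -- choice of the cofinal sets
  have : ∀ a : A, ∃ C : Set A, #C < κ ∧ (Order.cof (Iio a) < κ →
      ∀ b < a, ∃ c ∈ C, b ≤ c ∧ c < a) := by
    intro a
    by_cases ha : Order.cof (Iio a) < κ
    · obtain ⟨s, hs, hsc⟩ := Order.exists_cof_eq (Iio a)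
      refine ⟨Subtype.val '' s, ?_, fun _ b hb => ?_⟩
      · exact mk_image_le.trans_lt (hsc.trans_lt ha)
      · obtain ⟨c, hc, hbc⟩ := hs ⟨b, hb⟩
        exact ⟨c.1, ⟨c, hc, rfl⟩, hbc, c.2⟩
    · exact ⟨∅, by simpa using aleph0_pos.trans_le hκ, fun h => absurd h ha⟩
  choose C hC hC2 using this
  have : ∀ γ : A, ∃ γ' : A, {a | ∃ c ∈ C a, γ ≤ c ∧ c ≤ γ'} ∈ U := by
    intro γ
    have : ∀ a : A, ∃ c, Order.cof (Iio a) < κ → γ < a → c ∈ C a ∧ γ ≤ c ∧ c < a := by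
      intro a
      by_cases h : Order.cof (Iio a) < κ ∧ γ < a
      · obtain ⟨c, hc, h1, h2⟩ := hC2 a h.1 γ h.2
        exact ⟨c, fun _ _ => ⟨hc, h1, h2⟩⟩
      · exact ⟨a, fun h1 h2 => absurd ⟨h1, h2⟩ h⟩
    choose f hf using this
    obtain ⟨γ', hγ'⟩ := wn f (by
      filter_upwards [hsmall, hUt γ] with a h1 h2
      exact (hf a h1 h2).2.2)
    refine ⟨γ', ?_⟩
    filter_upwards [hsmall, hUt γ, hγ'] with a h1 h2 h3
    exact ⟨f a, (hf a h1 h2).1, (hf a h1 h2).2.1, h3⟩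
  choose h hh using this
  -- the disjoint intervals
  have hbd : ∀ (ξ : A) (F : ∀ η, η < ξ → A), ∃ b, ∀ η (hη : η < ξ), h (F η hη) < b := by
    intro ξ F
    obtain ⟨b, hb⟩ := exists_bound (range (fun η : Iio ξ => h (F η.1 η.2)))
      (mk_range_le.trans_lt (hI ξ))
    exact ⟨b, fun η hη => hb _ ⟨⟨η, hη⟩, rfl⟩⟩
  choose nxt hnxt using hbd
  let g : A → A := (wellFounded_lt (α := A)).fix nxt
  have hg : ∀ η ξ, η < ξ → h (g η) < g ξ := by
    intro η ξ hη
    have : g ξ = nxt ξ (fun y _ => g y) := WellFounded.fix_eq _ _ _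
    rw [this]
    exact hnxt ξ (fun y _ => g y) η hη
  refine ⟨U, hU, fun a => {ξ | ∃ c ∈ C a, g ξ ≤ c ∧ c ≤ h (g ξ)}, fun a => ?_, fun ξ => hh (g ξ)⟩
  refine lt_of_le_of_lt ?_ (hC a)
  have : ∀ ξ : {ξ | ∃ c ∈ C a, g ξ ≤ c ∧ c ≤ h (g ξ)}, ∃ c ∈ C a, g ξ ≤ c ∧ c ≤ h (g ξ) :=
    fun ξ => ξ.2
  choose c hc hc1 hc2 using this
  refine mk_le_of_injective (f := fun ξ => (⟨c ξ, hc ξ⟩ : C a)) ?_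
  intro x y hxy
  have hxy' : c x = c y := congrArg Subtype.val hxy
  rcases lt_trichotomy x.1 y.1 with hl | hl | hl
  · have h1 := (hc2 x).trans_lt ((hg _ _ hl).trans_le (hc1 y))
    exact absurd hxy' h1.ne
  · exact Subtype.ext hl
  · have h1 := (hc2 y).trans_lt ((hg _ _ hl).trans_le (hc1 x))
    exact absurd hxy' h1.ne'

end UsubaAux

/-- Usuba's characterization: for uncountable `δ ≤ κ`, `κ` is `δ`-strongly compact
if and only if every regular `λ ≥ κ` carries a `δ`-complete uniform ultrafilter. -/
theorem deltaSC_iff_uniform_ultrafilters (δ κ : Cardinal.{u})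
    (hδ : Cardinal.aleph0 < δ) (hδκ : δ ≤ κ) :
    IsDeltaStronglyCompact δ κ ↔
      ∀ lam : Cardinal.{u}, κ ≤ lam → lam.IsRegular →
        ∃ U : Ultrafilter lam.out, UFComplete δ U ∧ UFUniform U := by
  have hκ : Cardinal.aleph0 ≤ κ := (hδ.trans_le hδκ).le
  constructor
  · intro hSC lam hlam hreg
    obtain ⟨U, hU, hfine⟩ := hSC lam hlam
    have hcof : Order.cof lam.ord.ToType = lam := by
      rw [Ordinal.cof_toType, hreg.cof_ord]
    obtain ⟨e⟩ : Nonempty (lam.out ≃ lam.ord.ToType) := by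
      rw [← Cardinal.eq]; simp
    have hb : ∀ s : {s : Set lam.out // Cardinal.mk s < κ}, ∃ b : lam.out, ∀ x ∈ s.1, e x < e b := by
      intro s
      obtain ⟨b, hb⟩ := UsubaAux.exists_bound (e '' s.1)
        (by rw [hcof]; exact Cardinal.mk_image_le.trans_lt (s.2.trans_le hlam))
      exact ⟨e.symm b, fun x hx => by simpa using hb _ ⟨x, hx, rfl⟩⟩
    choose g hg using hb
    refine ⟨U.map g, UsubaAux.complete_map hU g, fun X hX => ?_⟩
    refine le_antisymm (Cardinal.mk_set_le X) ?_
    by_contra hlt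
    rw [not_le, Cardinal.mk_out] at hlt
    obtain ⟨b, hb⟩ := UsubaAux.exists_bound (e '' X)
      (by rw [hcof]; exact Cardinal.mk_image_le.trans_lt hlt)
    obtain ⟨s, hs1, hs2⟩ := U.nonempty_of_mem (Filter.inter_mem hX (hfine (e.symm b)))
    have h1 := hg s _ hs2
    have h2 := hb _ ⟨g s, hs1, rfl⟩
    rw [Equiv.apply_symm_apply] at h1
    exact lt_asymm h1 h2
  · intro H θ hθ
    have hreg : (Order.succ θ).IsRegular := Cardinal.isRegular_succ (hκ.trans hθ)
    have hcof : Order.cof (Order.succ θ).ord.ToType = Order.succ θ := by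
      rw [Ordinal.cof_toType, hreg.cof_ord]
    obtain ⟨U, hU, S, hS, hfine⟩ := UsubaAux.exists_fine (A := (Order.succ θ).ord.ToType) hδ hκ H
      (by rw [hcof]; exact hθ.trans (Order.le_succ θ))
      (by
        intro a
        rw [hcof]
        simpa using Cardinal.mk_Iio_lt a (by simp))
    obtain ⟨e⟩ : Nonempty (θ.out ↪ (Order.succ θ).ord.ToType) := by
      rw [← Cardinal.le_def]; simpa using Order.le_succ θ
    refine ⟨U.map (fun a => ⟨e ⁻¹' S a, ?_⟩), UsubaAux.complete_map hU _, fun x => hfine (e x)⟩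
    exact (Cardinal.mk_preimage_of_injective _ _ e.injective).trans_lt (hS a)
end

section
/- If κ is a 2-Mahlo cardinal and δ < κ is regular, the two-step iteration Q_{κ,δ} * Ḟ_{κ,δ} is forcing equivalent to the Cohen forcing Add(κ,1), since it has a <κ-closed dense subset of size κ and every <κ-closed separative poset of size κ (given 2^{<κ} = κ) is forcing equivalent to Add(κ,1). -/
universe u

/-- A node of the binary tree `2^{<κ}`: a binary sequence of some ordinal length. -/
def BNode : Type (u + 1) :=
  Σ β : Ordinal.{u}, ({x : Ordinal.{u} // x < β} → Bool)

/-- The height (level) of a node is its length. -/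
def BNode.ht (s : BNode.{u}) : Ordinal.{u} := s.1

/-- The restriction of a node to a smaller length. -/
def BNode.restrict (t : BNode.{u}) (β : Ordinal.{u}) (h : β ≤ t.1) : BNode.{u} :=
  ⟨β, fun x => t.2 ⟨x.1, lt_of_lt_of_le x.2 h⟩⟩

/-- Tree order on nodes: end extension. -/
def BNode.le (s t : BNode.{u}) : Prop :=
  s.1 ≤ t.1 ∧ ∀ x : {x : Ordinal.{u} // x < s.1}, ∀ hx : x.1 < t.1, s.2 x = t.2 ⟨x.1, hx⟩

/-- Strict tree order on nodes. -/
def BNode.slt (s t : BNode.{u}) : Prop := BNode.le s t ∧ s.1 < t.1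

/-- Replace the initial segment of `t` of length `s₁.1` by `s₁` ("swapping stems"). -/
noncomputable def BNode.swap (s₁ t : BNode.{u}) (h : s₁.1 ≤ t.1) : BNode.{u} :=
  ⟨t.1, fun x => if hx : x.1 < s₁.1 then s₁.2 ⟨x.1, hx⟩ else t.2 x⟩

/-- `C` is club in `κ`: unbounded in `κ` and closed under suprema below `κ`. -/
def IsClubIn (C : Set Ordinal.{u}) (κ : Ordinal.{u}) : Prop :=
  (∀ α < κ, ∃ β ∈ C, α < β ∧ β < κ) ∧
    ∀ α < κ, (0 : Ordinal.{u}) < α →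
      (∀ β < α, ∃ γ ∈ C, β < γ ∧ γ < α) → α ∈ C

/-- `S` is stationary in `κ`: it meets every club subset of `κ`. -/
def IsStationaryIn (S : Set Ordinal.{u}) (κ : Ordinal.{u}) : Prop :=
  ∀ C : Set Ordinal.{u}, IsClubIn C κ → ∃ x, x ∈ S ∧ x ∈ C ∧ x < κ

/-- `κ` is Mahlo: inaccessible, and the regular cardinals below `κ` are stationary. -/
def IsMahlo (κ : Cardinal.{u}) : Prop :=
  κ.IsInaccessible ∧
    IsStationaryIn {o : Ordinal.{u} | o.card.IsRegular ∧ o.card.ord = o} κ.ord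

/-- `κ` is 2-Mahlo: Mahlo, and the Mahlo cardinals below `κ` are stationary. -/
def Is2Mahlo (κ : Cardinal.{u}) : Prop :=
  IsMahlo κ ∧ IsStationaryIn {o : Ordinal.{u} | IsMahlo o.card ∧ o.card.ord = o} κ.ord

/-- A condition of Gitik's forcing `Q_{κ,δ}`: a normal homogeneous subtree of `2^{<κ}`
of successor height `top + 1 < κ`, together with a `δ`-ascent path `f` through it. -/
structure QCond (κ δ : Ordinal.{u}) : Type (u + 1) where
  /-- the top level of the tree; the tree has successor height `top + 1`. -/
  top : Ordinal.{u}
  top_lt : top + 1 < κ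
  /-- the tree. -/
  T : Set BNode.{u}
  mem_ht : ∀ t ∈ T, BNode.ht t < top + 1
  levels_nonempty : ∀ α < top + 1, ∃ t ∈ T, BNode.ht t = α
  downward_closed : ∀ t ∈ T, ∀ β : Ordinal.{u}, ∀ h : β ≤ BNode.ht t,
    BNode.restrict t β h ∈ T
  /-- normality: every node extends to every higher level below the height. -/
  normal : ∀ t ∈ T, ∀ α : Ordinal.{u}, BNode.ht t ≤ α → α < top + 1 →
    ∃ s ∈ T, BNode.ht s = α ∧ BNode.le t s
  /-- homogeneity: the cone above a node is invariant under swapping stems on a level. -/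
  homog : ∀ s₀ ∈ T, ∀ s₁ ∈ T, BNode.ht s₀ = BNode.ht s₁ →
    ∀ t ∈ T, BNode.le s₀ t → ∀ h : BNode.ht s₁ ≤ BNode.ht t, BNode.swap s₁ t h ∈ T
  /-- the `δ`-ascent path. -/
  f : Ordinal.{u} → Ordinal.{u} → BNode.{u}
  f_mem : ∀ α < top + 1, ∀ υ < δ, f α υ ∈ T ∧ BNode.ht (f α υ) = α
  f_ascent : ∀ α β : Ordinal.{u}, α < β → β < top + 1 →
    ∃ ξ < δ, ∀ υ : Ordinal.{u}, ξ ≤ υ → υ < δ → BNode.slt (f α υ) (f β υ)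

/-- The order on `Q_{κ,δ}`: end extension of the tree and of the ascent path. -/
def QLe {κ δ : Ordinal.{u}} (p q : QCond.{u} κ δ) : Prop :=
  q.top ≤ p.top ∧ q.T = {t ∈ p.T | BNode.ht t < q.top + 1} ∧
    ∀ α ≤ q.top, ∀ υ < δ, p.f α υ = q.f α υ

/-- A condition of the dense set `R₀` in `Q_{κ,δ} * Ḟ_{κ,δ}`: a condition `⟨t, f⃗⟩` of
`Q_{κ,δ}` together with `g = ⟨f_{ht(t)-1}, ξ⟩` for some `ξ < δ`, the `F`-part acting at
the top level of the tree. -/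
structure RCond (κ δ : Ordinal.{u}) extends QCond.{u} κ δ : Type (u + 1) where
  /-- the starting point of the `F_{κ,δ}`-condition. -/
  ξ : Ordinal.{u}
  ξ_lt : ξ < δ

/-- The order on `R₀`: extension in `Q_{κ,δ}`, equality of the `ξ`'s, and coordinatewise
tree-extension of the top functions above `ξ`. -/
def RLe {κ δ : Ordinal.{u}} (p q : RCond.{u} κ δ) : Prop :=
  QLe p.toQCond q.toQCond ∧ p.ξ = q.ξ ∧
    ∀ υ : Ordinal.{u}, p.ξ ≤ υ → υ < δ → BNode.le (q.f q.top υ) (p.f p.top υ)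

/-- A condition of the two-step iteration `Q_{κ,δ} * Ḟ_{κ,δ}`: a condition `q ∈ Q_{κ,δ}`
together with a `Q_{κ,δ}`-name `N` for a condition of `F_{κ,δ}`.  Since a condition of
`F_{κ,δ}` is a pair `⟨f_α, ξ⟩` determined by two ordinals, the name is given by the sets
`N α ξ` of conditions (below `q`) forcing its value to be `⟨f_α, ξ⟩`. -/
structure ItCond (κ δ : Ordinal.{u}) : Type (u + 1) where
  /-- the `Q_{κ,δ}`-part. -/
  q : QCond.{u} κ δ
  /-- the name for the `F_{κ,δ}`-part. -/
  N : Ordinal.{u} → Ordinal.{u} → Set (QCond.{u} κ δ)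
  coherent : ∀ α ξ : Ordinal.{u}, ∀ r ∈ N α ξ, QLe r q ∧ α ≤ r.top ∧ ξ < δ
  down_closed : ∀ α ξ : Ordinal.{u}, ∀ r ∈ N α ξ, ∀ r' : QCond.{u} κ δ,
    QLe r' r → r' ∈ N α ξ
  value_unique : ∀ α₁ ξ₁ α₂ ξ₂ : Ordinal.{u}, ∀ r : QCond.{u} κ δ,
    r ∈ N α₁ ξ₁ → r ∈ N α₂ ξ₂ → α₁ = α₂ ∧ ξ₁ = ξ₂
  densely_decided : ∀ r : QCond.{u} κ δ, QLe r q →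
    ∃ r' : QCond.{u} κ δ, QLe r' r ∧ ∃ α ξ : Ordinal.{u}, r' ∈ N α ξ

/-- The iteration order on `Q_{κ,δ} * Ḟ_{κ,δ}`: the `Q`-parts extend and the `Q`-part of
the extension forces the named `F`-conditions to extend (same `ξ` and coordinatewise
tree-extension above `ξ`, as computed from any condition deciding both names). -/
def ItLe {κ δ : Ordinal.{u}} (p q : ItCond.{u} κ δ) : Prop :=
  QLe p.q q.q ∧
    ∀ r : QCond.{u} κ δ, QLe r p.q → ∀ α₁ ξ₁ α₂ ξ₂ : Ordinal.{u},
      r ∈ p.N α₁ ξ₁ → r ∈ q.N α₂ ξ₂ →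
        ξ₁ = ξ₂ ∧ ∀ υ : Ordinal.{u}, ξ₁ ≤ υ → υ < δ → BNode.le (r.f α₂ υ) (r.f α₁ υ)

/-- The regularization operator on subsets of a poset. -/
def DOp {P : Type*} (le : P → P → Prop) (A : Set P) : Set P :=
  {p : P | ∀ q : P, le q p → ∃ r : P, le r q ∧ r ∈ A}

/-- The regular open algebra of a poset, ordered by inclusion. -/
def RO {P : Type*} (le : P → P → Prop) := {A : Set P // DOp le A = A}

instance {P : Type*} (le : P → P → Prop) : PartialOrder (RO le) :=
  Subtype.partialOrder _

/-- Two posets are forcing equivalent if their regular open algebras are isomorphic. -/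
def ForcingEquiv {P Q : Type*} (leP : P → P → Prop) (leQ : Q → Q → Prop) : Prop :=
  Nonempty (RO leP ≃o RO leQ)

/-- The Cohen forcing `Add(κ,1)`: partial binary functions on `κ` of size `< κ`,
ordered by reverse inclusion. -/
def AddCond (κ : Ordinal.{u}) : Type (u + 1) :=
  {s : Set (Ordinal.{u} × Bool) //
    (∀ p ∈ s, p.1 < κ) ∧ (∀ p ∈ s, ∀ q ∈ s, p.1 = q.1 → p.2 = q.2) ∧
      Cardinal.mk s < Cardinal.lift.{u + 1} κ.card}

/-- The order on `Add(κ,1)`. -/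
def AddLe {κ : Ordinal.{u}} (s t : AddCond.{u} κ) : Prop := t.1 ⊆ s.1


theorem forcingEquiv_of_dense {D P : Type*} {leD : D → D → Prop} {leP : P → P → Prop}
    (rD : ∀ d, leD d d) (tD : ∀ a b c, leD a b → leD b c → leD a c)
    (rP : ∀ d, leP d d) (tP : ∀ a b c, leP a b → leP b c → leP a c)
    (e : D → P) (mono : ∀ a b, leD a b → leP (e a) (e b))
    (inc : ∀ a b p, leP p (e a) → leP p (e b) → ∃ c, leD c a ∧ leD c b)
    (dense : ∀ p, ∃ d, leP (e d) p) : ForcingEquiv leD leP := by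
  have dcD : ∀ B : Set D, DOp leD B = B → ∀ a b, leD a b → b ∈ B → a ∈ B := by
    intro B hB a b hab hb
    rw [← hB] at hb ⊢
    intro q hq
    exact hb q (tD _ _ _ hq hab)
  have dcP : ∀ B : Set P, DOp leP B = B → ∀ a b, leP a b → b ∈ B → a ∈ B := by
    intro B hB a b hab hb
    rw [← hB] at hb ⊢
    intro q hq
    exact hb q (tP _ _ _ hq hab)
  refine ⟨OrderIso.symm ?_⟩
  refine
    { toFun := fun A => ⟨{d | e d ∈ A.1}, ?_⟩
      invFun := fun B => ⟨{p | ∀ d, leP (e d) p → d ∈ B.1}, ?_⟩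
      left_inv := ?_
      right_inv := ?_
      map_rel_iff' := ?_ }
  · obtain ⟨A, hA⟩ := A
    ext d
    constructor
    · intro hd
      change e d ∈ A
      rw [← hA]
      intro q hq
      obtain ⟨d', hd'⟩ := dense q
      obtain ⟨c, hc1, hc2⟩ := inc d' d (e d') (rP _) (tP _ _ _ hd' hq)
      obtain ⟨r, hr, hrA⟩ := hd c hc2
      exact ⟨e r, tP _ _ _ (mono _ _ (tD _ _ _ hr hc1)) hd', hrA⟩
    · intro hd q hq
      exact ⟨q, rD q, dcP A hA _ _ (mono _ _ hq) hd⟩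
  · obtain ⟨B, hB⟩ := B
    ext p
    constructor
    · intro hp d hd
      change d ∈ B
      rw [← hB]
      intro d' hd'
      obtain ⟨r, hr, hrB⟩ := hp (e d') (tP _ _ _ (mono _ _ hd') hd)
      obtain ⟨d2, hd2⟩ := dense r
      have h2 : d2 ∈ B := hrB d2 hd2
      obtain ⟨c, hc1, hc2⟩ := inc d2 d' (e d2) (rP _) (tP _ _ _ hd2 hr)
      exact ⟨c, hc2, dcD B hB _ _ hc1 h2⟩
    · intro hp q hq
      exact ⟨q, rP q, fun d hd => hp d (tP _ _ _ hd hq)⟩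
  · rintro ⟨A, hA⟩
    apply Subtype.ext
    ext p
    constructor
    · intro hp
      change p ∈ A
      rw [← hA]
      intro q hq
      obtain ⟨d, hd⟩ := dense q
      exact ⟨e d, hd, hp d (tP _ _ _ hd hq)⟩
    · intro hp d hd
      exact dcP A hA _ _ hd hp
  · rintro ⟨B, hB⟩
    apply Subtype.ext
    ext d
    constructor
    · intro hd
      exact hd d (rP _)
    · intro hd d' hd'
      change d' ∈ B
      rw [← hB]
      intro d'' hd''
      obtain ⟨c, hc1, hc2⟩ := inc d'' d (e d'') (rP _) (tP _ _ _ (mono _ _ hd'') hd')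
      exact ⟨c, hc1, dcD B hB _ _ hc2 hd⟩
  · rintro ⟨A, hA⟩ ⟨A', hA'⟩
    constructor
    · intro h p hp
      change p ∈ A'
      rw [← hA']
      intro q hq
      obtain ⟨d, hd⟩ := dense q
      exact ⟨e d, hd, h (dcP A hA _ _ (tP _ _ _ hd hq) hp)⟩
    · intro h d hd
      exact h hd

theorem ForcingEquiv.symm' {P Q : Type*} {leP : P → P → Prop} {leQ : Q → Q → Prop}
    (h : ForcingEquiv leP leQ) : ForcingEquiv leQ leP := h.map OrderIso.symm

theorem ForcingEquiv.trans' {P Q R : Type*} {leP : P → P → Prop} {leQ : Q → Q → Prop}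
    {leR : R → R → Prop} (h : ForcingEquiv leP leQ) (h' : ForcingEquiv leQ leR) :
    ForcingEquiv leP leR := by
  obtain ⟨a⟩ := h
  obtain ⟨b⟩ := h'
  exact ⟨a.trans b⟩

/-- Descending sequences. -/
theorem desc_seq {K P : Type*} [LinearOrder K] [WellFoundedLT K] {le : P → P → Prop}
    (rP : ∀ d, le d d) (tP : ∀ a b c, le a b → le b c → le a c)
    (closed : ∀ (l : P) (i : K) (f : K → P), (∀ j < i, le (f j) l) →
      (∀ j j', j ≤ j' → j' < i → le (f j') (f j)) → ∃ m, le m l ∧ ∀ j < i, le m (f j))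
    (step : K → P → P) (hstep : ∀ i m, le (step i m) m) (l : P) :
    ∃ (q m : K → P), (∀ i, q i = step i (m i)) ∧ (∀ i, le (m i) l) ∧
      (∀ i j, j < i → le (m i) (q j)) := by
  classical
  let lb : Set P → P := fun S =>
    if h : ∃ m, le m l ∧ ∀ s ∈ S, le m s then Classical.choose h else l
  have lb_spec : ∀ S, (∃ m, le m l ∧ ∀ s ∈ S, le m s) → le (lb S) l ∧ ∀ s ∈ S, le (lb S) s := by
    intro S h
    simp only [lb, dif_pos h]
    exact Classical.choose_spec h
  have wf : WellFounded ((· < ·) : K → K → Prop) := wellFounded_lt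
  let q : K → P := wf.fix (fun i rec => step i (lb {p | ∃ j, ∃ h : j < i, p = rec j h}))
  have hq : ∀ i, q i = step i (lb {p | ∃ j, ∃ _ : j < i, p = q j}) := by
    intro i
    exact wf.fix_eq _ i
  have key : ∀ i, le (lb {p | ∃ j, ∃ _ : j < i, p = q j}) l ∧
      ∀ j < i, le (lb {p | ∃ j, ∃ _ : j < i, p = q j}) (q j) := by
    intro i
    induction i using wf.induction with
    | _ i ih =>
      have hex : ∃ m, le m l ∧ ∀ s ∈ {p | ∃ j, ∃ _ : j < i, p = q j}, le m s := by
        obtain ⟨m, hm1, hm2⟩ := closed l i q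
          (fun j hj => by
            rw [hq j]
            exact tP _ _ _ (hstep _ _) (ih j hj).1)
          (fun j j' hjj hj' => by
            rcases hjj.eq_or_lt with rfl | hlt
            · exact rP _
            · rw [hq j']
              exact tP _ _ _ (hstep _ _) ((ih j' hj').2 j hlt))
        refine ⟨m, hm1, ?_⟩
        rintro s ⟨j, hj, rfl⟩
        exact hm2 j hj
      obtain ⟨h1, h2⟩ := lb_spec _ hex
      exact ⟨h1, fun j hj => h2 _ ⟨j, hj, rfl⟩⟩
  exact ⟨q, fun i => lb {p | ∃ j, ∃ _ : j < i, p = q j}, hq, fun i => (key i).1,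
    fun i j hj => (key i).2 j hj⟩

/-- Every element with the splitting property carries an antichain of size `K` inside a
given dense open set, which extends to a maximal one. -/
theorem child_exists {K P : Type*} [LinearOrder K] [WellFoundedLT K] {le : P → P → Prop}
    (rP : ∀ d, le d d) (tP : ∀ a b c, le a b → le b c → le a c)
    (closed : ∀ (l : P) (i : K) (f : K → P), (∀ j < i, le (f j) l) →
      (∀ j j', j ≤ j' → j' < i → le (f j') (f j)) → ∃ m, le m l ∧ ∀ j < i, le m (f j))
    (atomless : ∀ p, ∃ a b, le a p ∧ le b p ∧ ∀ r, le r a → ¬ le r b)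
    (d : K → P) (hd : ∀ p, ∃ i, le (d i) p)
    (S : Set P) (hS : ∃ m, ∀ s ∈ S, le m s) (z : P) :
    ∃ c : K → P, (∀ i, ∀ s ∈ S, le (c i) s) ∧
      (∀ i, le (c i) z ∨ ∀ r, le r (c i) → ¬ le r z) ∧
      (∀ i j r, le r (c i) → le r (c j) → i = j) ∧
      (∀ m, (∀ s ∈ S, le m s) → ∃ i r, le r m ∧ le r (c i)) := by
  classical
  let L : Set P := {p | (∀ s ∈ S, le p s) ∧ (le p z ∨ ∀ r, le r p → ¬ le r z)}
  have Lopen : ∀ p q, le q p → p ∈ L → q ∈ L := by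
    rintro p q hqp ⟨h1, h2⟩
    refine ⟨fun s hs => tP _ _ _ hqp (h1 s hs), ?_⟩
    rcases h2 with h2 | h2
    · exact Or.inl (tP _ _ _ hqp h2)
    · exact Or.inr fun r hr => h2 r (tP _ _ _ hr hqp)
  have Ldense : ∀ m, (∀ s ∈ S, le m s) → ∃ p ∈ L, le p m := by
    intro m hm
    by_cases h : ∃ r, le r m ∧ le r z
    · obtain ⟨r, hr, hrz⟩ := h
      exact ⟨r, ⟨fun s hs => tP _ _ _ hr (hm s hs), Or.inl hrz⟩, hr⟩
    · push Not at h
      exact ⟨m, ⟨hm, Or.inr h⟩, rP m⟩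
  obtain ⟨m0, hm0⟩ := hS
  obtain ⟨l, hl, -⟩ := Ldense m0 hm0
  choose a b ha hb hab using atomless
  obtain ⟨q, m, hq, hml, hmq⟩ := desc_seq rP tP closed (fun _ p => a p) (fun _ p => ha p) l
  let r0 : K → P := fun i => b (m i)
  have r0_inc : ∀ i j r, i < j → le r (r0 i) → ¬ le r (r0 j) := by
    intro i j r hij h1 h2
    refine hab (m i) r ?_ h1
    have h3 : le (m j) (a (m i)) := by
      have := hmq j i hij
      rwa [hq i] at this
    exact tP _ _ _ (tP _ _ _ h2 (hb _)) h3
  have r0_inc' : ∀ i j r, le r (r0 i) → le r (r0 j) → i = j := by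
    intro i j r h1 h2
    rcases lt_trichotomy i j with h | h | h
    · exact absurd h2 (r0_inc i j r h h1)
    · exact h
    · exact absurd h1 (r0_inc j i r h h2)
  have r0_inj : Function.Injective r0 := fun i j h =>
    r0_inc' i j (r0 i) (rP _) (h ▸ rP _)
  let AC : Set (Set P) := {A | A ⊆ L ∧ ∀ x ∈ A, ∀ y ∈ A, ∀ r, le r x → le r y → x = y}
  have hA0 : Set.range r0 ∈ AC := by
    constructor
    · rintro _ ⟨i, rfl⟩
      exact Lopen _ _ (tP _ _ _ (hb _) (hml i)) hl
    · rintro _ ⟨i, rfl⟩ _ ⟨j, rfl⟩ r h1 h2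
      rw [r0_inc' i j r h1 h2]
  obtain ⟨A, hA0A, hAmax⟩ := zorn_subset_nonempty AC (by
    intro c hc hchain hne
    refine ⟨⋃₀ c, ⟨?_, ?_⟩, fun s hs => Set.subset_sUnion_of_mem hs⟩
    · exact Set.sUnion_subset fun s hs => (hc hs).1
    · rintro x ⟨s, hs, hx⟩ y ⟨t, ht, hy⟩ r h1 h2
      rcases hchain.total hs ht with h | h
      · exact (hc ht).2 x (h hx) y hy r h1 h2
      · exact (hc hs).2 x hx y (h hy) r h1 h2) (Set.range r0) hA0
  have hAC : A ∈ AC := hAmax.prop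
  choose idx hidx using hd
  obtain ⟨g, hg⟩ := Function.Embedding.schroeder_bernstein
    (f := fun i : K => (⟨r0 i, hA0A ⟨i, rfl⟩⟩ : A)) (g := fun x : A => idx x.1)
    (fun i j h => r0_inj (congrArg Subtype.val h))
    (fun x y h => by
      apply Subtype.ext
      refine hAC.2 _ x.2 _ y.2 (d (idx x.1)) (hidx _) ?_
      have h' : idx x.1 = idx y.1 := h
      rw [h']
      exact hidx _)
  refine ⟨fun i => (g i).1, fun i => (hAC.1 (g i).2).1, fun i => (hAC.1 (g i).2).2, ?_, ?_⟩
  · intro i j r h1 h2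
    exact hg.1 (Subtype.ext (hAC.2 _ (g i).2 _ (g j).2 r h1 h2))
  · intro m hm
    obtain ⟨p, hpL, hpm⟩ := Ldense m hm
    by_contra hcon
    push Not at hcon
    have hcon' : ∀ x ∈ A, ∀ r, le r p → ¬ le r x := by
      intro x hx r hr hrx
      obtain ⟨i, hi⟩ := hg.2 ⟨x, hx⟩
      refine hcon i r (tP _ _ _ hr hpm) ?_
      rw [hi]
      exact hrx
    have hins : insert p A ∈ AC := by
      constructor
      · exact Set.insert_subset hpL hAC.1
      · rintro x (rfl | hx) y (rfl | hy) r h1 h2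
        · rfl
        · exact absurd h2 (hcon' y hy r h1)
        · exact absurd h1 (hcon' x hx r h2)
        · exact hAC.2 x hx y hy r h1 h2
    have : p ∈ A := hAmax.le_of_ge hins (Set.subset_insert _ _) (Set.mem_insert _ _)
    exact hcon' p this p (rP _) (rP _)

/-- The tree order on `K × (K → K)`. -/
def TreeLe {K : Type*} [LinearOrder K] (s t : K × (K → K)) : Prop :=
  t.1 ≤ s.1 ∧ ∀ j ≤ t.1, s.2 j = t.2 j

theorem tree_equiv {K P : Type*} [LinearOrder K] [WellFoundedLT K] {le : P → P → Prop}
    (rP : ∀ d, le d d) (tP : ∀ a b c, le a b → le b c → le a c) (hne : Nonempty P)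
    (closed : ∀ (l : P) (i : K) (f : K → P), (∀ j < i, le (f j) l) →
      (∀ j j', j ≤ j' → j' < i → le (f j') (f j)) → ∃ m, le m l ∧ ∀ j < i, le m (f j))
    (atomless : ∀ p, ∃ a b, le a p ∧ le b p ∧ ∀ r, le r a → ¬ le r b)
    (d : K → P) (hd : ∀ p, ∃ i, le (d i) p) :
    ForcingEquiv (TreeLe (K := K)) le := by
  classical
  have hc0 := fun (S : Set P) (hS : ∃ m, ∀ s ∈ S, le m s) (z : P) =>
    child_exists rP tP closed atomless d hd S hS z
  choose c0 hc1 hc2 hc3 hc4 using hc0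
  let c : K → Set P → K → P := fun α S =>
    if h : ∃ m, ∀ s ∈ S, le m s then c0 S h (d α) else fun _ => hne.some
  have wf : WellFounded ((· < ·) : K → K → Prop) := wellFounded_lt
  let E : (K → K) → K → P := fun x =>
    wf.fix (fun i rec => c i {p | ∃ j, ∃ h : j < i, p = rec j h} (x i))
  let prev : (K → K) → K → Set P := fun x i => {p | ∃ j, ∃ _ : j < i, p = E x j}
  have hE : ∀ x i, E x i = c i (prev x i) (x i) := fun x i => wf.fix_eq _ i
  have hprev : ∀ x i, ∃ m, ∀ s ∈ prev x i, le m s := by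
    intro x i
    induction i using wf.induction with
    | _ i ih =>
      by_cases hi : ∃ j, j < i
      · obtain ⟨j0, hj0⟩ := hi
        have anti : ∀ j j', j ≤ j' → j' < i → le (E x j') (E x j) := by
          intro j j' hjj hj'
          rcases hjj.eq_or_lt with rfl | hlt
          · exact rP _
          · rw [hE x j']
            simp only [c, dif_pos (ih j' hj')]
            exact hc1 _ _ _ _ _ ⟨j, hlt, rfl⟩
        obtain ⟨b0, hb0⟩ : ∃ b0, ∀ j, b0 ≤ j := by
          refine ⟨wf.min Set.univ ⟨i, trivial⟩, fun j => ?_⟩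
          exact not_lt.1 (wf.not_lt_min Set.univ (Set.mem_univ j))
        obtain ⟨m, -, hm⟩ := closed (E x b0) i (E x)
          (fun j hj => anti b0 j (hb0 j) hj) anti
        refine ⟨m, ?_⟩
        rintro s ⟨j, hj, rfl⟩
        exact hm j hj
      · refine ⟨hne.some, ?_⟩
        rintro s ⟨j, hj, -⟩
        exact absurd ⟨j, hj⟩ hi
  have hE' : ∀ x i, E x i = c0 (prev x i) (hprev x i) (d i) (x i) := by
    intro x i
    rw [hE x i]
    simp only [c, dif_pos (hprev x i)]
  have anti : ∀ x j j', j ≤ j' → le (E x j') (E x j) := by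
    intro x j j' hjj
    rcases hjj.eq_or_lt with rfl | hlt
    · exact rP _
    · rw [hE' x j']
      exact hc1 _ _ _ _ _ ⟨j, hlt, rfl⟩
  have congrE : ∀ x y i, (∀ j ≤ i, x j = y j) → E x i = E y i := by
    intro x y i
    induction i using wf.induction with
    | _ i ih =>
      intro h
      have : prev x i = prev y i := by
        ext p
        constructor
        · rintro ⟨j, hj, rfl⟩
          exact ⟨j, hj, ih j hj fun k hk => h k (hk.trans hj.le)⟩
        · rintro ⟨j, hj, rfl⟩
          exact ⟨j, hj, (ih j hj fun k hk => h k (hk.trans hj.le)).symm⟩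
      rw [hE, hE, this, h i le_rfl]
  have uniq : ∀ x y i r, le r (E x i) → le r (E y i) → ∀ j ≤ i, x j = y j := by
    intro x y i
    induction i using wf.induction with
    | _ i ih =>
      intro r h1 h2
      have hlt : ∀ j < i, x j = y j := fun j hj =>
        ih j hj r (tP _ _ _ h1 (anti x j i hj.le)) (tP _ _ _ h2 (anti y j i hj.le)) j le_rfl
      have hp : prev x i = prev y i := by
        ext p
        constructor
        · rintro ⟨j, hj, rfl⟩
          exact ⟨j, hj, congrE _ _ _ fun k hk => hlt k (hk.trans_lt hj)⟩
        · rintro ⟨j, hj, rfl⟩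
          exact ⟨j, hj, (congrE _ _ _ fun k hk => hlt k (hk.trans_lt hj)).symm⟩
      intro j hj
      rcases hj.eq_or_lt with rfl | hj
      · rw [hE, hp] at h1
        rw [hE] at h2
        simp only [c, dif_pos (hprev y j)] at h1 h2
        exact hc3 _ _ _ _ _ r h1 h2
      · exact hlt j hj
  refine forcingEquiv_of_dense (fun s => ⟨le_rfl, fun _ _ => rfl⟩) ?_ rP tP
    (fun s => E s.2 s.1) ?_ ?_ ?_
  · rintro s t u ⟨h1, h2⟩ ⟨h3, h4⟩
    exact ⟨h3.trans h1, fun j hj => (h2 j (hj.trans h3)).trans (h4 j hj)⟩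
  · rintro ⟨α, x⟩ ⟨β, y⟩ ⟨h1, h2⟩
    change le (E x α) (E y β)
    rw [← congrE x y β h2]
    exact anti x β α h1
  · rintro ⟨α, x⟩ ⟨β, y⟩ r h1 h2
    rcases le_total β α with h | h
    · exact ⟨(α, x), ⟨le_rfl, fun _ _ => rfl⟩,
        ⟨h, uniq x y β r (tP _ _ _ h1 (anti x β α h)) h2⟩⟩
    · exact ⟨(β, y), ⟨h, uniq y x α r (tP _ _ _ h2 (anti y α β h)) h1⟩,
        ⟨le_rfl, fun _ _ => rfl⟩⟩
  · intro p
    obtain ⟨α, hα⟩ := hd p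
    let step : K → P → P := fun i m =>
      if h : ∃ p, le p m ∧ ∃ x, le p (E x i) then Classical.choose h else m
    have hs1 : ∀ i m, le (step i m) m := by
      intro i m
      by_cases h : ∃ p, le p m ∧ ∃ x, le p (E x i)
      · simp only [step, dif_pos h]
        exact (Classical.choose_spec h).1
      · simp only [step, dif_neg h]
        exact rP _
    have hs2 : ∀ i m, (∃ p, le p m ∧ ∃ x, le p (E x i)) → ∃ x, le (step i m) (E x i) := by
      intro i m h
      simp only [step, dif_pos h]
      exact (Classical.choose_spec h).2
    obtain ⟨q, m, hq, hml, hmq⟩ := desc_seq rP tP closed step hs1 (d α)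
    have hqq : ∀ i j, j ≤ i → le (q i) (q j) := by
      intro i j hj
      rcases hj.eq_or_lt with rfl | hj
      · exact rP _
      · rw [hq i]
        exact tP _ _ _ (hs1 _ _) (hmq i j hj)
    have key : ∀ i, ∃ x, le (q i) (E x i) := by
      intro i
      induction i using wf.induction with
      | _ i ih =>
        choose xs hxs using ih
        let x : K → K := fun j => if h : j < i then xs j h j else j
        have hx : ∀ j (hj : j < i), E (xs j hj) j = E x j := by
          intro j hj
          apply congrE
          intro k hk
          have hki : k < i := hk.trans_lt hj
          simp only [x, dif_pos hki]
          exact uniq (xs j hj) (xs k hki) k (q j)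
            (tP _ _ _ (hxs j hj) (anti _ k j hk)) (tP _ _ _ (hqq j k hk) (hxs k hki)) k le_rfl
        have hm : ∀ s ∈ prev x i, le (m i) s := by
          rintro s ⟨j, hj, rfl⟩
          rw [← hx j hj]
          exact tP _ _ _ (hmq i j hj) (hxs j hj)
        obtain ⟨k, r, hr1, hr2⟩ := hc4 (prev x i) (hprev x i) (d i) (m i) hm
        rw [hq i]
        refine hs2 i (m i) ⟨r, hr1, Function.update x i k, ?_⟩
        have hp : prev (Function.update x i k) i = prev x i := by
          have : ∀ j < i, E (Function.update x i k) j = E x j := fun j hj =>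
            congrE _ _ _ fun k' hk' => Function.update_of_ne (hk'.trans_lt hj).ne _ _
          ext p
          constructor
          · rintro ⟨j, hj, rfl⟩
            exact ⟨j, hj, this j hj⟩
          · rintro ⟨j, hj, rfl⟩
            exact ⟨j, hj, (this j hj).symm⟩
        rw [hE, hp]
        simp only [c, dif_pos (hprev x i), Function.update_self]
        exact hr2
    obtain ⟨x, hx⟩ := key α
    refine ⟨(α, x), ?_⟩
    have hqd : le (q α) (d α) := by
      rw [hq α]
      exact tP _ _ _ (hs1 _ _) (hml α)
    change le (E x α) p
    refine tP _ _ _ ?_ hα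
    have := hc2 (prev x α) (hprev x α) (d α) (x α)
    rw [← hE'] at this
    rcases this with h | h
    · exact h
    · exact absurd hqd (h _ hx)

open Cardinal in
theorem two_power_lt_lift {κ : Cardinal.{u}} (hκ : κ.IsInaccessible) {c : Cardinal.{u + 1}}
    (hc : c < Cardinal.lift.{u + 1} κ) : 2 ^ c < Cardinal.lift.{u + 1} κ := by
  obtain ⟨d, hd, hdc⟩ := Cardinal.lt_lift_iff.1 hc
  rw [← hdc, ← Cardinal.lift_two_power, Cardinal.lift_lt]
  exact hκ.isStrongLimit.isStrongPrelimit hd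

open Cardinal in
theorem dense_index {κ : Cardinal.{u}} (hκ : κ.IsInaccessible) {P : Type (u + 1)}
    (le : P → P → Prop) (hne : Nonempty P)
    (Y : Set.Iio κ.ord → Type (u + 1)) (hY : ∀ α, #(Y α) < Cardinal.lift.{u + 1} κ)
    (code : P → Σ α, Set (Y α)) (hc : ∀ p q, code p = code q → le p q) :
    ∃ d : Set.Iio κ.ord → P, ∀ p, ∃ i, le (d i) p := by
  classical
  have hK : #(Set.Iio κ.ord) = Cardinal.lift.{u + 1} κ := by
    rw [Cardinal.mk_Iio_ordinal, Cardinal.card_ord]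
  have hinf : ℵ₀ ≤ Cardinal.lift.{u + 1} κ := by
    rw [Cardinal.aleph0_le_lift]
    exact hκ.isRegular.aleph0_le
  have hS : #(Σ α, Set (Y α)) ≤ #(Set.Iio κ.ord) := by
    rw [Cardinal.mk_sigma]
    calc Cardinal.sum (fun α => #(Set (Y α)))
        ≤ Cardinal.sum (fun _ : Set.Iio κ.ord => Cardinal.lift.{u + 1} κ) := by
          apply Cardinal.sum_le_sum
          intro α
          rw [Cardinal.mk_set]
          exact (two_power_lt_lift hκ (hY α)).le
      _ = #(Set.Iio κ.ord) * Cardinal.lift.{u + 1} κ := by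
          rw [Cardinal.sum_const']
      _ = #(Set.Iio κ.ord) := by
          rw [hK, Cardinal.mul_eq_self hinf]
  obtain ⟨g⟩ := hS
  refine ⟨fun i => if h : ∃ p, g (code p) = i then Classical.choose h else hne.some, ?_⟩
  intro p
  refine ⟨g (code p), ?_⟩
  have h : ∃ p', g (code p') = g (code p) := ⟨p, rfl⟩
  simp only [dif_pos h]
  exact hc _ _ (g.injective (Classical.choose_spec h))

open Cardinal in
theorem mk_Iio_lt {κ : Cardinal.{u}} {α : Ordinal.{u}} (h : α < κ.ord) :
    #(Set.Iio α) < Cardinal.lift.{u + 1} κ := by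
  rw [Cardinal.mk_Iio_ordinal, Cardinal.lift_lt]
  exact Cardinal.lt_ord.1 h

theorem succ_lt_ord {κ : Cardinal.{u}} (hκ : κ.IsInaccessible) {α : Ordinal.{u}}
    (h : α < κ.ord) : α + 1 < κ.ord :=
  (Cardinal.isSuccLimit_ord hκ.isRegular.aleph0_le).add_one_lt h

/-- Suprema of fewer than `κ` ordinals below `κ`. -/
theorem exists_sup_lt {κ : Cardinal.{u}} (hκ : κ.IsInaccessible) {ι : Type (u + 1)}
    (hι : Cardinal.mk ι < Cardinal.lift.{u + 1} κ) (f : ι → Ordinal.{u})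
    (hf : ∀ i, f i < κ.ord) : ∃ γ < κ.ord, (∀ i, f i ≤ γ) ∧ ∀ α < γ, ∃ i, α < f i := by
  obtain ⟨d, hd, hdc⟩ := Cardinal.lt_lift_iff.1 hι
  rw [← Cardinal.mk_out d, ← Cardinal.mk_uLift, Cardinal.eq] at hdc
  obtain ⟨g⟩ := hdc
  refine ⟨⨆ i : d.out, f (g ⟨i⟩), ?_, fun i => ?_, fun α hα => ?_⟩
  · apply Ordinal.iSup_lt_of_lt_cof
    · rw [Cardinal.mk_out, hκ.isRegular.cof_ord]
      exact hd
    · exact fun i => hf _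
  · have := Ordinal.le_iSup (fun i : d.out => f (g ⟨i⟩)) (g.symm i).down
    have h2 : g ⟨(g.symm i).down⟩ = i := g.apply_symm_apply i
    rwa [h2] at this
  · obtain ⟨i, hi⟩ := Ordinal.lt_iSup_iff.1 hα
    exact ⟨_, hi⟩

open Cardinal in
theorem add_tree_equiv {κ : Cardinal.{u}} (hκ : κ.IsInaccessible) :
    ForcingEquiv (TreeLe (K := Set.Iio κ.ord)) (AddLe (κ := κ.ord)) := by
  classical
  have hreg : (Cardinal.lift.{u + 1} κ).IsRegular := hκ.isRegular.lift
  have hinf : ℵ₀ ≤ Cardinal.lift.{u + 1} κ := hreg.aleph0_le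
  have hne : Nonempty (AddCond.{u} κ.ord) :=
    ⟨⟨∅, by simp, by simp, by
      rw [Cardinal.mk_eq_zero, Cardinal.card_ord]
      exact hreg.pos⟩⟩
  have hbd : ∀ s : AddCond.{u} κ.ord, ∃ α < κ.ord, ∀ p ∈ s.1, p.1 < α := by
    rintro ⟨s, h1, h2, h3⟩
    rw [Cardinal.card_ord] at h3
    obtain ⟨γ, hγ, hle, -⟩ := exists_sup_lt hκ h3 (fun p => p.1.1) (fun p => h1 _ p.2)
    exact ⟨γ + 1, succ_lt_ord hκ hγ, fun p hp => Order.lt_add_one_iff.2 (hle ⟨p, hp⟩)⟩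
  choose bd hbd1 hbd2 using hbd
  have hdense := dense_index hκ (AddLe (κ := κ.ord)) hne
    (fun α => Set.Iio α.1 × Bool) (by
      rintro ⟨α, hα⟩
      rw [Cardinal.mk_prod, Cardinal.lift_id']
      refine Cardinal.mul_lt_of_lt hinf (mk_Iio_lt hα) ?_
      refine lt_of_lt_of_le ?_ hinf
      rw [Cardinal.lift_lt_aleph0]
      exact Cardinal.lt_aleph0_of_finite _)
    (fun s => ⟨⟨bd s, hbd1 s⟩, {y | (y.1.1, y.2) ∈ s.1}⟩) (by
      intro p q hpq
      obtain ⟨h1, h2⟩ := Sigma.mk.inj_iff.1 hpq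
      have h1' : bd p = bd q := congrArg Subtype.val h1
      intro y hy
      have hq := hbd2 q y hy
      have hp : y.1 < bd p := h1' ▸ hq
      generalize hα : (⟨bd p, hbd1 p⟩ : Set.Iio κ.ord) = α at *
      generalize hβ : (⟨bd q, hbd1 q⟩ : Set.Iio κ.ord) = β at *
      subst h1
      have h3 := eq_of_heq h2
      have hy1 : y.1 < α.1 := by rw [← hα]; exact hp
      have : ((⟨y.1, hy1⟩, y.2) : Set.Iio α.1 × Bool) ∈ {z : Set.Iio α.1 × Bool | (z.1.1, z.2) ∈ q.1} := hy
      rw [← h3] at this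
      exact this)
  obtain ⟨d, hd⟩ := hdense
  refine tree_equiv (fun s => subset_rfl) (fun a b c h1 h2 => Set.Subset.trans h2 h1) hne ?_ ?_ d hd
  · intro l i f hl hf
    refine ⟨⟨l.1 ∪ ⋃ j : Set.Iio i.1, (f ⟨j.1, lt_trans (Set.mem_Iio.1 j.2) i.2⟩).1, ?_, ?_, ?_⟩,
      Set.subset_union_left, fun j hj => ?_⟩
    · rintro p (hp | hp)
      · exact l.2.1 p hp
      · obtain ⟨j, hj⟩ := Set.mem_iUnion.1 hp
        exact (f _).2.1 p hj
    · by_cases hi : ∃ j, j < i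
      · have key : ∀ p ∈ l.1 ∪ ⋃ j : Set.Iio i.1, (f ⟨j.1, lt_trans (Set.mem_Iio.1 j.2) i.2⟩).1,
            ∃ j < i, p ∈ (f j).1 := by
          rintro p (hp | hp)
          · obtain ⟨j, hj⟩ := hi
            exact ⟨j, hj, hl j hj hp⟩
          · obtain ⟨j, hj⟩ := Set.mem_iUnion.1 hp
            exact ⟨⟨j.1, lt_trans (Set.mem_Iio.1 j.2) i.2⟩, j.2, hj⟩
        intro p hp q hq
        obtain ⟨j, hj, hp⟩ := key p hp
        obtain ⟨k, hk, hq⟩ := key q hq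
        rcases le_total j k with h | h
        · exact (f k).2.2.1 p (hf j k h hk hp) q hq
        · exact (f j).2.2.1 p hp q (hf k j h hj hq)
      · have key : ∀ p ∈ l.1 ∪ ⋃ j : Set.Iio i.1, (f ⟨j.1, lt_trans (Set.mem_Iio.1 j.2) i.2⟩).1, p ∈ l.1 := by
          rintro p (hp | hp)
          · exact hp
          · obtain ⟨j, hj⟩ := Set.mem_iUnion.1 hp
            exact absurd ⟨⟨j.1, lt_trans (Set.mem_Iio.1 j.2) i.2⟩, j.2⟩ hi
        intro p hp q hq
        exact l.2.2.1 p (key p hp) q (key q hq)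
    · have hl3 := l.2.2.2
      have hk : Cardinal.lift.{u + 1} κ.ord.card = Cardinal.lift.{u + 1} κ := by
        rw [Cardinal.card_ord]
      refine lt_of_lt_of_eq ?_ hk.symm
      replace hl3 := lt_of_lt_of_eq hl3 hk
      refine lt_of_le_of_lt (Cardinal.mk_union_le _ _) (Cardinal.add_lt_of_lt hinf hl3 ?_)
      rw [Cardinal.card_iUnion_lt_iff_forall_of_isRegular hreg (mk_Iio_lt i.2)]
      intro j
      have := (f ⟨j.1, lt_trans (Set.mem_Iio.1 j.2) i.2⟩).2.2.2
      exact lt_of_lt_of_eq this hk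
    · intro p hp
      exact Or.inr (Set.mem_iUnion.2 ⟨⟨j.1, hj⟩, hp⟩)
  · intro s
    have mk : ∀ b : Bool, ∃ t : AddCond.{u} κ.ord, AddLe t s ∧ (bd s, b) ∈ t.1 := by
      intro b
      refine ⟨⟨insert (bd s, b) s.1, ?_, ?_, ?_⟩, Set.subset_insert _ _, Set.mem_insert _ _⟩
      · rintro p (rfl | hp)
        · exact hbd1 s
        · exact s.2.1 p hp
      · rintro p (rfl | hp) q (rfl | hq) h
        · rfl
        · exact absurd h.symm (hbd2 s q hq).ne
        · exact absurd h (hbd2 s p hp).ne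
        · exact s.2.2.1 p hp q hq h
      · have hs : #s.1 < Cardinal.lift.{u + 1} κ := lt_of_lt_of_eq s.2.2.2 (by rw [Cardinal.card_ord])
        have hk : Cardinal.lift.{u + 1} κ.ord.card = Cardinal.lift.{u + 1} κ := by
          rw [Cardinal.card_ord]
        refine lt_of_lt_of_eq ?_ hk.symm
        refine lt_of_le_of_lt Cardinal.mk_insert_le ?_
        exact Cardinal.add_lt_of_lt hinf hs (lt_of_lt_of_le Cardinal.one_lt_aleph0 hinf)
    obtain ⟨a, ha, ha'⟩ := mk true
    obtain ⟨b, hb, hb'⟩ := mk false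
    refine ⟨a, b, ha, hb, fun r h1 h2 => ?_⟩
    have := r.2.2.1 _ (h1 ha') _ (h2 hb') rfl
    simp at this

theorem ord_lt_succ (γ : Ordinal.{u}) : γ < γ + 1 := Order.lt_add_one_iff.2 le_rfl

/-- The value of a node at an ordinal (with default `false`). -/
noncomputable def BNode.val (t : BNode.{u}) (x : Ordinal.{u}) : Bool :=
  if h : x < t.1 then t.2 ⟨x, h⟩ else false

/-- A node from a total function. -/
def BNode.cut (γ : Ordinal.{u}) (g : Ordinal.{u} → Bool) : BNode.{u} := ⟨γ, fun x => g x.1⟩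

theorem BNode.val_cut {γ : Ordinal.{u}} {g : Ordinal.{u} → Bool} {x : Ordinal.{u}} (h : x < γ) :
    (BNode.cut γ g).val x = g x := by
  have h' : x < (BNode.cut γ g).1 := h
  rw [BNode.val, dif_pos h']
  rfl

theorem BNode.ext_val {s t : BNode.{u}} (h : s.1 = t.1) (hv : ∀ x < s.1, s.val x = t.val x) :
    s = t := by
  obtain ⟨a, s⟩ := s
  obtain ⟨b, t⟩ := t
  dsimp only at h
  subst h
  congr 1
  funext x
  have := hv x.1 x.2
  simp only [BNode.val] at this
  rw [dif_pos x.2, dif_pos x.2] at this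
  exact this

theorem BNode.le_iff {s t : BNode.{u}} :
    BNode.le s t ↔ s.1 ≤ t.1 ∧ ∀ x < s.1, s.val x = t.val x := by
  constructor
  · rintro ⟨h1, h2⟩
    refine ⟨h1, fun x hx => ?_⟩
    rw [BNode.val, BNode.val, dif_pos hx, dif_pos (hx.trans_le h1)]
    exact h2 ⟨x, hx⟩ _
  · rintro ⟨h1, h2⟩
    refine ⟨h1, fun x hx => ?_⟩
    have := h2 x.1 x.2
    rw [BNode.val, BNode.val, dif_pos x.2, dif_pos hx] at this
    exact this

theorem BNode.le_rfl' (s : BNode.{u}) : BNode.le s s := BNode.le_iff.2 ⟨le_rfl, fun _ _ => rfl⟩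

theorem BNode.le_trans' {s t r : BNode.{u}} (h1 : BNode.le s t) (h2 : BNode.le t r) :
    BNode.le s r := by
  rw [BNode.le_iff] at *
  exact ⟨h1.1.trans h2.1, fun x hx => (h1.2 x hx).trans (h2.2 x (hx.trans_le h1.1))⟩

theorem BNode.restrict_eq (t : BNode.{u}) (β : Ordinal.{u}) (h : β ≤ t.1) :
    BNode.restrict t β h = BNode.cut β t.val := by
  refine BNode.ext_val rfl fun x hx => ?_
  have hx' : x < β := hx
  rw [BNode.val_cut hx', BNode.val, BNode.val, dif_pos hx, dif_pos (hx'.trans_le h)]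
  rfl

/-- The values of a swapped node. -/
noncomputable def BNode.sw (s t : BNode.{u}) : Ordinal.{u} → Bool :=
  fun x => if x < s.1 then s.val x else t.val x

theorem BNode.swap_eq (s t : BNode.{u}) (h : s.1 ≤ t.1) :
    BNode.swap s t h = BNode.cut t.1 (BNode.sw s t) := by
  refine BNode.ext_val rfl fun x hx => ?_
  have hx' : x < t.1 := hx
  rw [BNode.val_cut hx', BNode.val, dif_pos hx]
  simp only [BNode.swap, BNode.sw, BNode.val]
  by_cases h1 : x < s.1
  · simp only [dif_pos h1, if_pos h1]
  · simp only [dif_neg h1, if_neg h1, dif_pos hx']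

theorem BNode.cut_self {t : BNode.{u}} {γ : Ordinal.{u}} (h : t.1 = γ) :
    BNode.cut γ t.val = t := by
  subst h
  exact BNode.ext_val rfl fun x hx => BNode.val_cut hx

theorem BNode.cut_congr {γ : Ordinal.{u}} {g g' : Ordinal.{u} → Bool}
    (h : ∀ x < γ, g x = g' x) : BNode.cut γ g = BNode.cut γ g' :=
  BNode.ext_val rfl fun x (hx : x < γ) => by rw [BNode.val_cut hx, BNode.val_cut hx, h x hx]

section

variable {κ δ : Ordinal.{u}}

theorem QCond.down (p : QCond.{u} κ δ) {t : BNode.{u}} (ht : t ∈ p.T) {β : Ordinal.{u}}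
    (h : β ≤ t.1) : BNode.cut β t.val ∈ p.T := by
  rw [← BNode.restrict_eq t β h]
  exact p.downward_closed t ht β h

theorem QCond.hom (p : QCond.{u} κ δ) {s₀ s₁ t : BNode.{u}} (h0 : s₀ ∈ p.T) (h1 : s₁ ∈ p.T)
    (h : s₀.1 = s₁.1) (ht : t ∈ p.T) (hle : BNode.le s₀ t) :
    BNode.cut t.1 (BNode.sw s₁ t) ∈ p.T := by
  have h' : s₁.1 ≤ t.1 := h ▸ hle.1
  rw [← BNode.swap_eq s₁ t h']
  exact p.homog s₀ h0 s₁ h1 h t ht hle h'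

/-- Adding a top level to a tree. -/
theorem add_level (γ : Ordinal.{u}) (hγ : γ + 1 < κ) (T : Set BNode.{u})
    (f : Ordinal.{u} → Ordinal.{u} → BNode.{u}) (B : Set BNode.{u})
    (F : Ordinal.{u} → BNode.{u})
    (hT : ∀ t ∈ T, t.1 < γ) (hlev : ∀ α < γ, ∃ t ∈ T, t.1 = α)
    (hdown : ∀ t ∈ T, ∀ β ≤ t.1, BNode.cut β t.val ∈ T)
    (hnorm : ∀ t ∈ T, ∀ α, t.1 ≤ α → α < γ → ∃ s ∈ T, s.1 = α ∧ BNode.le t s)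
    (hhom : ∀ s₀ ∈ T, ∀ s₁ ∈ T, s₀.1 = s₁.1 → ∀ t ∈ T, BNode.le s₀ t →
      BNode.cut t.1 (BNode.sw s₁ t) ∈ T)
    (hf : ∀ α < γ, ∀ υ < δ, f α υ ∈ T ∧ (f α υ).1 = α)
    (hfa : ∀ α β, α < β → β < γ → ∃ ξ < δ, ∀ υ, ξ ≤ υ → υ < δ → BNode.slt (f α υ) (f β υ))
    (hBne : B.Nonempty) (hB : ∀ b ∈ B, b.1 = γ ∧ ∀ β < γ, BNode.cut β b.val ∈ T)
    (hF : ∀ υ < δ, F υ ∈ B)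
    (hFa : ∀ α < γ, ∃ ξ < δ, ∀ υ, ξ ≤ υ → υ < δ → BNode.le (f α υ) (F υ)) :
    ∃ p : QCond.{u} κ δ, p.top = γ ∧
      p.T = T ∪ {t | t.1 = γ ∧ (∀ β < γ, BNode.cut β t.val ∈ T) ∧ ∃ b ∈ B, ∃ β, (β < γ ∨ β = 0) ∧
        ∀ x, β ≤ x → x < γ → t.val x = b.val x} ∧
      (∀ α < γ, p.f α = f α) ∧ p.f γ = F := by
  classical
  have swT : ∀ s ∈ T, ∀ t : BNode.{u}, (∀ β < γ, BNode.cut β t.val ∈ T) →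
      ∀ β < γ, BNode.cut β (BNode.sw s t) ∈ T := by
    intro s hs t ht β hβ
    rcases le_total β s.1 with h | h
    · have : BNode.cut β (BNode.sw s t) = BNode.cut β s.val :=
        BNode.cut_congr fun x hx => by rw [BNode.sw, if_pos (hx.trans_le h)]
      rw [this]
      exact hdown s hs β h
    · have := hhom (BNode.cut s.1 t.val) (ht _ (hT s hs)) s hs rfl (BNode.cut β t.val) (ht β hβ)
        (BNode.le_iff.2 ⟨h, fun x (hx : x < s.1) => by
          rw [BNode.val_cut hx, BNode.val_cut (hx.trans_le h)]⟩)
      have e : BNode.cut (BNode.cut β t.val).1 (BNode.sw s (BNode.cut β t.val)) =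
          BNode.cut β (BNode.sw s t) :=
        BNode.cut_congr fun x (hx : x < β) => by
          simp only [BNode.sw]
          rw [BNode.val_cut hx]
      rwa [e] at this
  have cutB : ∀ s ∈ T, ∀ t : BNode.{u}, t.1 = γ → (∀ β < γ, BNode.cut β t.val ∈ T) →
      ∀ β < γ, BNode.cut β (BNode.cut γ (BNode.sw s t)).val ∈ T := by
    intro s hs t _ ht β hβ
    have : BNode.cut β (BNode.cut γ (BNode.sw s t)).val = BNode.cut β (BNode.sw s t) :=
      BNode.cut_congr fun x hx => BNode.val_cut (hx.trans hβ)
    rw [this]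
    exact swT s hs t ht β hβ
  have hBT : ∀ b ∈ B, b ∈ {t : BNode.{u} | t.1 = γ ∧ (∀ β < γ, BNode.cut β t.val ∈ T) ∧
      ∃ b ∈ B, ∃ β, (β < γ ∨ β = 0) ∧ ∀ x, β ≤ x → x < γ → t.val x = b.val x} :=
    fun b hb => ⟨(hB b hb).1, (hB b hb).2, b, hb, 0, Or.inr rfl, fun _ _ _ => rfl⟩
  obtain ⟨b0, hb0⟩ := hBne
  refine ⟨
    { top := γ
      top_lt := hγ
      T := T ∪ {t | t.1 = γ ∧ (∀ β < γ, BNode.cut β t.val ∈ T) ∧ ∃ b ∈ B, ∃ β, (β < γ ∨ β = 0) ∧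
        ∀ x, β ≤ x → x < γ → t.val x = b.val x}
      mem_ht := ?_
      levels_nonempty := ?_
      downward_closed := ?_
      normal := ?_
      homog := ?_
      f := fun α => if α < γ then f α else F
      f_mem := ?_
      f_ascent := ?_ }, rfl, rfl, ?_, ?_⟩
  · rintro t (ht | ht)
    · exact (hT t ht).trans (ord_lt_succ γ)
    · exact ht.1.trans_lt (ord_lt_succ γ)
  · intro α hα
    rcases (Order.lt_add_one_iff.1 hα).lt_or_eq with h | rfl
    · obtain ⟨t, ht, h'⟩ := hlev α h
      exact ⟨t, Or.inl ht, h'⟩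
    · exact ⟨b0, Or.inr (hBT b0 hb0), (hB b0 hb0).1⟩
  · intro t ht β hβ
    rw [BNode.restrict_eq t β hβ]
    rcases ht with ht | ht
    · exact Or.inl (hdown t ht β hβ)
    · have hβ' : β ≤ γ := hβ.trans_eq ht.1
      rcases hβ'.lt_or_eq with h | h
      · exact Or.inl (ht.2.1 β h)
      · rw [BNode.cut_self (ht.1.trans h.symm)]
        exact Or.inr ht
  · intro t ht α hα1 hα2
    rcases ht with ht | ht
    · rcases (Order.lt_add_one_iff.1 hα2).lt_or_eq with h | rfl
      · obtain ⟨s, hs, h1, h2⟩ := hnorm t ht α hα1 h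
        exact ⟨s, Or.inl hs, h1, h2⟩
      · refine ⟨BNode.cut α (BNode.sw t b0), Or.inr ⟨rfl, ?_, b0, hb0, t.1, Or.inl (hT t ht), ?_⟩,
          rfl, ?_⟩
        · exact cutB t ht b0 (hB b0 hb0).1 (hB b0 hb0).2
        · intro x hx1 hx2
          rw [BNode.val_cut hx2, BNode.sw, if_neg (not_lt.2 hx1)]
        · refine BNode.le_iff.2 ⟨hα1, fun x hx => ?_⟩
          rw [BNode.val_cut (hx.trans_le hα1), BNode.sw, if_pos hx]
    · have h1 : t.1 = α := by
        apply le_antisymm hα1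
        change α ≤ t.1
        rw [ht.1]
        exact Order.lt_add_one_iff.1 hα2
      exact ⟨t, Or.inr ht, h1, BNode.le_rfl' t⟩
  · intro s₀ hs0 s₁ hs1 hs t ht hle h
    rw [BNode.swap_eq s₁ t h]
    have hs' : s₀.1 = s₁.1 := hs
    have h' : s₁.1 ≤ t.1 := h
    rcases ht with ht | ht
    · have htγ := hT t ht
      have hs1' : s₁ ∈ T := by
        rcases hs1 with h1 | h1
        · exact h1
        · exact absurd (h'.trans_lt htγ) (by rw [h1.1]; exact lt_irrefl _)
      have hs0' : s₀ ∈ T := by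
        rcases hs0 with h1 | h1
        · exact h1
        · exact absurd (h'.trans_lt htγ) (by rw [← hs', h1.1]; exact lt_irrefl _)
      exact Or.inl (hhom s₀ hs0' s₁ hs1' hs t ht hle)
    · rcases hs1 with h1 | h1
      · have hlt := hT s₁ h1
        refine Or.inr ?_
        rw [ht.1]
        obtain ⟨ht1, ht2, b, hb, β, hβ, hbx⟩ := ht
        refine ⟨rfl, cutB s₁ h1 t ht1 ht2, b, hb, max β s₁.1, ?_, ?_⟩
        · left
          rcases hβ with hβ | rfl
          · exact max_lt hβ hlt
          · exact max_lt (lt_of_le_of_lt (zero_le) hlt) hlt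
        · intro x hx1 hx2
          rw [BNode.val_cut hx2, BNode.sw, if_neg (not_lt.2 ((le_max_right _ _).trans hx1))]
          exact hbx x ((le_max_left _ _).trans hx1) hx2
      · have : BNode.cut t.1 (BNode.sw s₁ t) = s₁ := by
          refine BNode.ext_val (ht.1.trans h1.1.symm) fun x (hx : x < t.1) => ?_
          have hx' : x < s₁.1 := by rwa [h1.1, ← ht.1]
          rw [BNode.val_cut hx, BNode.sw, if_pos hx']
        rw [this]
        exact Or.inr h1
  · intro α hα υ hυ
    rcases (Order.lt_add_one_iff.1 hα).lt_or_eq with h | rfl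
    · simp only [if_pos h]
      exact ⟨Or.inl (hf α h υ hυ).1, (hf α h υ hυ).2⟩
    · simp only [lt_irrefl, if_false]
      exact ⟨Or.inr (hBT _ (hF υ hυ)), (hB _ (hF υ hυ)).1⟩
  · intro α β hαβ hβ
    rcases (Order.lt_add_one_iff.1 hβ).lt_or_eq with h | rfl
    · simp only [if_pos h, if_pos (hαβ.trans h)]
      exact hfa α β hαβ h
    · simp only [if_pos hαβ, lt_irrefl, if_false]
      obtain ⟨ξ, hξ, h⟩ := hFa α hαβ
      refine ⟨ξ, hξ, fun υ h1 h2 => ⟨h υ h1 h2, ?_⟩⟩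
      rw [(hf α hαβ υ h2).2, (hB _ (hF υ h2)).1]
      exact hαβ
  · intro α hα
    simp only [if_pos hα]
  · simp only [lt_irrefl, if_false]

theorem succ_ext (hδ : 0 < δ) (p : QCond.{u} κ δ) (hκ : p.top + 1 + 1 < κ)
    (g : Ordinal.{u} → BNode.{u}) (hg : ∀ υ < δ, g υ ∈ p.T ∧ (g υ).1 = p.top)
    (hga : ∀ α < p.top + 1, ∃ ξ < δ, ∀ υ, ξ ≤ υ → υ < δ → BNode.le (p.f α υ) (g υ)) (c : Bool) :
    ∃ p' : QCond.{u} κ δ, p'.top = p.top + 1 ∧ QLe p' p ∧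
      (∀ υ < δ, BNode.le (g υ) (p'.f p'.top υ)) ∧
      (c = false → ∀ t ∈ p'.T, t.1 = p.top + 1 → t.val p.top = false) ∧
      (c = true → ∃ t ∈ p'.T, t.1 = p.top + 1 ∧ t.val p.top = true) := by
  classical
  have hlt : p.top < p.top + 1 := ord_lt_succ _
  let ap : BNode.{u} → Bool → BNode.{u} := fun t d =>
    BNode.cut (p.top + 1) (fun x => if x < p.top then t.val x else d)
  have hap : ∀ t ∈ p.T, t.1 = p.top → ∀ d, ∀ β < p.top + 1, BNode.cut β (ap t d).val ∈ p.T := by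
    intro t ht htop d β hβ
    have hβ' : β ≤ p.top := Order.lt_add_one_iff.1 hβ
    have : BNode.cut β (ap t d).val = BNode.cut β t.val :=
      BNode.cut_congr fun x hx => by
        rw [BNode.val_cut (hx.trans hβ), if_pos (hx.trans_le hβ')]
    rw [this]
    exact p.down ht (hβ'.trans_eq htop.symm)
  have hap2 : ∀ t d, (ap t d).val p.top = d := by
    intro t d
    rw [BNode.val_cut hlt, if_neg (lt_irrefl _)]
  have hap3 : ∀ t d, t.1 = p.top → BNode.le t (ap t d) := by
    intro t d ht
    refine BNode.le_iff.2 ⟨ht.trans_le hlt.le, fun x hx => ?_⟩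
    rw [ht] at hx
    rw [BNode.val_cut (hx.trans hlt), if_pos hx]
  let B : Set BNode.{u} := {b | b.1 = p.top + 1 ∧ (∀ β < p.top + 1, BNode.cut β b.val ∈ p.T) ∧
    (b.val p.top = true → c = true)}
  have hFB : ∀ υ < δ, ap (g υ) false ∈ B := by
    intro υ hυ
    refine ⟨rfl, hap _ (hg υ hυ).1 (hg υ hυ).2 false, ?_⟩
    rw [hap2]
    intro h
    cases h
  obtain ⟨p', h1, h2, h3, h4⟩ := add_level (κ := κ) (δ := δ) (p.top + 1) hκ p.T p.f B
    (fun υ => ap (g υ) false) p.mem_ht p.levels_nonempty (fun t ht β h => p.down ht h)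
    p.normal (fun s0 h0 s1 h1 h t ht hle => p.hom h0 h1 h ht hle) p.f_mem p.f_ascent
    ⟨_, hFB 0 hδ⟩ (fun b hb => ⟨hb.1, hb.2.1⟩) hFB (by
      intro α hα
      obtain ⟨ξ, hξ, h⟩ := hga α hα
      exact ⟨ξ, hξ, fun υ h1 h2 => BNode.le_trans' (h υ h1 h2) (hap3 _ _ (hg υ h2).2)⟩)
  refine ⟨p', h1, ⟨?_, ?_, ?_⟩, ?_, ?_, ?_⟩
  · rw [h1]
    exact hlt.le
  · rw [h2]
    ext t
    constructor
    · intro ht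
      exact ⟨Or.inl ht, p.mem_ht t ht⟩
    · rintro ⟨ht | ht, hlt'⟩
      · exact ht
      · exact absurd hlt' (by
          change ¬ t.1 < _
          rw [ht.1]
          exact lt_irrefl _)
  · intro α hα υ _
    rw [h3 α (Order.lt_add_one_iff.2 hα)]
  · intro υ hυ
    rw [h1, h4]
    exact hap3 _ _ (hg υ hυ).2
  · intro hc t ht htop
    rw [h2] at ht
    rcases ht with ht | ⟨-, -, b, hb, β, hβ, hx⟩
    · exact absurd (p.mem_ht t ht) (by
        change ¬ t.1 < _
        rw [htop]
        exact lt_irrefl _)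
    · have hβ' : β ≤ p.top := by
        rcases hβ with h | rfl
        · exact Order.lt_add_one_iff.1 h
        · exact zero_le
      rw [hx p.top hβ' hlt]
      by_contra hne
      have := hb.2.2 (by simpa using hne)
      rw [hc] at this
      cases this
  · intro hc
    refine ⟨ap (g 0) true, ?_, rfl, hap2 _ _⟩
    rw [h2]
    refine Or.inr ⟨rfl, hap _ (hg 0 hδ).1 (hg 0 hδ).2 true, ap (g 0) true,
      ⟨rfl, hap _ (hg 0 hδ).1 (hg 0 hδ).2 true, fun _ => hc⟩, 0, Or.inr rfl, fun _ _ _ => rfl⟩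

theorem QLe.rfl' (p : QCond.{u} κ δ) : QLe p p := by
  refine ⟨le_rfl, ?_, fun _ _ _ _ => rfl⟩
  ext t
  exact ⟨fun h => ⟨h, p.mem_ht t h⟩, fun h => h.1⟩

theorem QLe.trans' {p q r : QCond.{u} κ δ} (h1 : QLe p q) (h2 : QLe q r) : QLe p r := by
  refine ⟨h2.1.trans h1.1, ?_, fun α hα υ hυ =>
    (h1.2.2 α (hα.trans h2.1) υ hυ).trans (h2.2.2 α hα υ hυ)⟩
  rw [h2.2.1, h1.2.1]
  ext t
  have : r.top + 1 ≤ q.top + 1 := by gcongr; exact h2.1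
  exact ⟨fun h => ⟨h.1.1, h.2⟩, fun h => ⟨⟨h.1, h.2.trans_le this⟩, h.2⟩⟩

theorem RLe.rfl' (p : RCond.{u} κ δ) : RLe p p :=
  ⟨QLe.rfl' _, rfl, fun _ _ _ => BNode.le_rfl' _⟩

theorem RLe.trans' {p q r : RCond.{u} κ δ} (h1 : RLe p q) (h2 : RLe q r) : RLe p r :=
  ⟨h1.1.trans' h2.1, h1.2.1.trans h2.2.1, fun υ hυ hυ' =>
    BNode.le_trans' (h2.2.2 υ (h1.2.1 ▸ hυ) hυ') (h1.2.2 υ hυ hυ')⟩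

theorem RLe.symm_of_top {p q : RCond.{u} κ δ} (h : RLe p q) (ht : p.top ≤ q.top) : RLe q p := by
  have htop : q.top = p.top := le_antisymm h.1.1 ht
  have hf := h.1.2.2
  refine ⟨⟨ht, ?_, fun α hα υ hυ => (hf α (hα.trans ht) υ hυ).symm⟩, h.2.1.symm, ?_⟩
  · rw [h.1.2.1]
    ext t
    refine ⟨fun h' => ⟨⟨h', ?_⟩, p.mem_ht t h'⟩, fun h' => h'.1.1⟩
    rw [htop]
    exact p.mem_ht t h'
  · intro υ _ hυ
    rw [← htop, hf q.top le_rfl υ hυ]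
    exact BNode.le_rfl' _

theorem limit_ext {ι : Type (u + 1)} (hne : Nonempty ι) (p : ι → RCond.{u} κ δ)
    (hp : ∀ i j, RLe (p i) (p j) ∨ RLe (p j) (p i)) (γ : Ordinal.{u}) (hγ : γ + 1 < κ)
    (htop : ∀ i, (p i).top ≤ γ) (hsup : ∀ α < γ, ∃ i, α < (p i).top) :
    ∃ m, ∀ i, RLe m (p i) := by
  classical
  have hcmp : ∀ i j, (p i).top ≤ (p j).top → RLe (p j) (p i) := by
    intro i j h
    rcases hp i j with h' | h'
    · exact h'.symm_of_top h
    · exact h'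
  by_cases hmax : ∃ i, (p i).top = γ
  · obtain ⟨i, hi⟩ := hmax
    exact ⟨p i, fun j => hcmp j i ((htop j).trans_eq hi.symm)⟩
  have hlt : ∀ i, (p i).top < γ := fun i => lt_of_le_of_ne (htop i) fun h => hmax ⟨i, h⟩
  choose ix hix using hsup
  obtain ⟨i0⟩ := hne
  have hξ : ∀ i, (p i).ξ = (p i0).ξ := by
    intro i
    rcases hp i i0 with h | h
    · exact h.2.1
    · exact h.2.1.symm
  have hle : ∀ i j υ, (p i0).ξ ≤ υ → υ < δ → (p i).top ≤ (p j).top →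
      BNode.le ((p i).f (p i).top υ) ((p j).f (p j).top υ) := fun i j υ h1 h2 h =>
    (hcmp i j h).2.2 υ ((hξ j).trans_le h1) h2
  let T : Set BNode.{u} := {t | ∃ i, t ∈ (p i).T}
  have hmem : ∀ i, ∀ t ∈ T, t.1 ≤ (p i).top → t ∈ (p i).T := by
    rintro i t ⟨j, hj⟩ ht
    rcases le_total (p i).top (p j).top with h | h
    · rw [(hcmp i j h).1.2.1]
      exact ⟨hj, Order.lt_add_one_iff.2 ht⟩
    · rw [(hcmp j i h).1.2.1] at hj
      exact hj.1
  have hht : ∀ i, ∀ t ∈ (p i).T, t.1 ≤ (p i).top := fun i t ht =>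
    Order.lt_add_one_iff.1 ((p i).mem_ht t ht)
  let f : Ordinal.{u} → Ordinal.{u} → BNode.{u} := fun α υ =>
    if h : α < γ then (p (ix α h)).f α υ else BNode.cut 0 (fun _ => false)
  have hf : ∀ i α υ, α ≤ (p i).top → υ < δ → f α υ = (p i).f α υ := by
    intro i α υ hα hυ
    have h : α < γ := hα.trans_lt (hlt i)
    simp only [f, dif_pos h]
    rcases le_total (p i).top (p (ix α h)).top with h' | h'
    · exact (hcmp _ _ h').1.2.2 α hα υ hυ
    · exact ((hcmp _ _ h').1.2.2 α (hix α h).le υ hυ).symm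
  have hlen : ∀ i υ, υ < δ → ((p i).f (p i).top υ).1 = (p i).top := fun i υ hυ =>
    ((p i).f_mem _ (ord_lt_succ _) υ hυ).2
  let b : Ordinal.{u} → BNode.{u} := fun υ => BNode.cut γ (fun x =>
    if h : x < γ then ((p (ix x h)).f (p (ix x h)).top υ).val x else false)
  have hb : ∀ i υ, (p i0).ξ ≤ υ → υ < δ → BNode.le ((p i).f (p i).top υ) (b υ) := by
    intro i υ h1 h2
    refine BNode.le_iff.2 ⟨?_, fun x hx => ?_⟩
    · rw [hlen i υ h2]
      exact htop i
    · rw [hlen i υ h2] at hx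
      have hxγ : x < γ := hx.trans (hlt i)
      rw [BNode.val_cut hxγ, dif_pos hxγ]
      rcases le_total (p i).top (p (ix x hxγ)).top with h' | h'
      · exact (BNode.le_iff.1 (hle _ _ υ h1 h2 h')).2 x (by rwa [hlen i υ h2])
      · exact ((BNode.le_iff.1 (hle _ _ υ h1 h2 h')).2 x
          (by rw [hlen _ υ h2]; exact hix x hxγ)).symm
  have hδ0 := (p i0).ξ_lt
  obtain ⟨m, h1, h2, h3, h4⟩ := add_level (κ := κ) (δ := δ) γ hγ T f
    {t | ∃ υ, (p i0).ξ ≤ υ ∧ υ < δ ∧ t = b υ}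
    (fun υ => if (p i0).ξ ≤ υ then b υ else b (p i0).ξ)
    (by
      rintro t ⟨i, hi⟩
      exact (hht i t hi).trans_lt (hlt i))
    (by
      intro α hα
      obtain ⟨t, ht, h⟩ := (p (ix α hα)).levels_nonempty α
        ((hix α hα).trans (ord_lt_succ _))
      exact ⟨t, ⟨_, ht⟩, h⟩)
    (by
      rintro t ⟨i, hi⟩ β hβ
      exact ⟨i, (p i).down hi hβ⟩)
    (by
      intro t ht α h1 h2
      obtain ⟨s, hs, h3⟩ := (p (ix α h2)).normal t (hmem _ t ht (h1.trans (hix α h2).le)) α h1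
        ((hix α h2).trans (ord_lt_succ _))
      exact ⟨s, ⟨_, hs⟩, h3⟩)
    (by
      rintro s0 hs0 s1 hs1 hs t ⟨i, hi⟩ hst
      have h0 : s0.1 ≤ (p i).top := hst.1.trans (hht i t hi)
      exact ⟨i, (p i).hom (hmem i s0 hs0 h0) (hmem i s1 hs1 (hs ▸ h0)) hs hi hst⟩)
    (by
      intro α hα υ hυ
      rw [hf (ix α hα) α υ (hix α hα).le hυ]
      obtain ⟨ha, hb⟩ := (p (ix α hα)).f_mem α ((hix α hα).trans (ord_lt_succ _)) υ hυ
      exact ⟨⟨_, ha⟩, hb⟩)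
    (by
      intro α β hαβ hβ
      obtain ⟨ξ, hξ, h⟩ := (p (ix β hβ)).f_ascent α β hαβ
        ((hix β hβ).trans (ord_lt_succ _))
      refine ⟨ξ, hξ, fun υ h1 h2 => ?_⟩
      rw [hf (ix β hβ) α υ (hαβ.le.trans (hix β hβ).le) h2, hf (ix β hβ) β υ (hix β hβ).le h2]
      exact h υ h1 h2)
    ⟨b (p i0).ξ, _, le_rfl, hδ0, rfl⟩
    (by
      rintro _ ⟨υ, h1, h2, rfl⟩
      refine ⟨rfl, fun β hβ => ⟨ix β hβ, ?_⟩⟩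
      have hl := BNode.le_iff.1 (hb (ix β hβ) υ h1 h2)
      have hn := hlen (ix β hβ) υ h2
      have : BNode.cut β (b υ).val =
          BNode.cut β ((p (ix β hβ)).f (p (ix β hβ)).top υ).val :=
        BNode.cut_congr fun x hx => (hl.2 x (by rw [hn]; exact hx.trans (hix β hβ))).symm
      rw [this]
      exact (p (ix β hβ)).down ((p (ix β hβ)).f_mem _ (ord_lt_succ _) υ h2).1
        (by rw [hn]; exact (hix β hβ).le))
    (by
      intro υ hυ
      by_cases h : (p i0).ξ ≤ υ
      · exact ⟨υ, h, hυ, if_pos h⟩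
      · exact ⟨_, le_rfl, hδ0, if_neg h⟩)
    (by
      intro α hα
      obtain ⟨ξ, hξ, h⟩ := (p (ix α hα)).f_ascent α _ (hix α hα) (ord_lt_succ _)
      refine ⟨max ξ (p i0).ξ, max_lt hξ hδ0, fun υ h1 h2 => ?_⟩
      have h3 : (p i0).ξ ≤ υ := (le_max_right _ _).trans h1
      simp only [if_pos h3]
      rw [hf (ix α hα) α υ (hix α hα).le h2]
      exact BNode.le_trans' (h υ ((le_max_left _ _).trans h1) h2).1 (hb _ υ h3 h2))
  refine ⟨⟨m, (p i0).ξ, hδ0⟩, fun i => ⟨⟨?_, ?_, ?_⟩, (hξ i).symm, ?_⟩⟩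
  · change (p i).top ≤ m.top
    rw [h1]
    exact htop i
  · change (p i).T = {t ∈ m.T | t.1 < (p i).top + 1}
    rw [h2]
    ext t
    constructor
    · intro ht
      exact ⟨Or.inl ⟨i, ht⟩, (p i).mem_ht t ht⟩
    · rintro ⟨ht | ht, hlt'⟩
      · exact hmem i t ht (Order.lt_add_one_iff.1 hlt')
      · rw [ht.1] at hlt'
        exact absurd (Order.lt_add_one_iff.1 hlt') (not_le.2 (hlt i))
  · intro α hα υ hυ
    change m.f α υ = (p i).f α υ
    rw [h3 α (hα.trans_lt (hlt i))]
    exact hf i α υ hα hυ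
  · intro υ h5 h6
    change BNode.le ((p i).f (p i).top υ) (m.f m.top υ)
    rw [h1, h4]
    have h5' : (p i0).ξ ≤ υ := h5
    simp only [if_pos h5']
    exact hb i υ h5' h6

end

open Cardinal in
theorem mk_nodes_lt {κ : Cardinal.{u}} (hκ : κ.IsInaccessible) {α : Ordinal.{u}}
    (hα : α < κ.ord) : #{t : BNode.{u} // t.1 ≤ α} < Cardinal.lift.{u + 1} κ := by
  have hinf : ℵ₀ ≤ Cardinal.lift.{u + 1} κ := hκ.isRegular.lift.aleph0_le
  have h1 := mk_Iio_lt (succ_lt_ord hκ hα)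
  refine lt_of_le_of_lt (Cardinal.mk_le_of_injective
    (β := Set.Iio (α + 1) × Set (Set.Iio (α + 1)))
    (f := fun t => (⟨t.1.1, Order.lt_add_one_iff.2 t.2⟩, {x | t.1.val x.1 = true})) ?_) ?_
  · rintro ⟨s, hs⟩ ⟨t, ht⟩ h
    obtain ⟨h1, h2⟩ := Prod.mk_inj.1 h
    apply Subtype.ext
    refine BNode.ext_val (congrArg Subtype.val h1) fun x hx => ?_
    have hx' : x < α + 1 := Order.lt_add_one_iff.2 (hx.le.trans hs)
    have := Set.ext_iff.1 h2 ⟨x, hx'⟩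
    exact Bool.eq_iff_iff.2 this
  · rw [Cardinal.mk_prod, Cardinal.lift_id, Cardinal.lift_id, Cardinal.mk_set]
    exact Cardinal.mul_lt_of_lt hinf h1 (two_power_lt_lift hκ h1)

theorem RLe.of_eq {κ δ : Ordinal.{u}} {p q : RCond.{u} κ δ} (h1 : p.top = q.top) (h2 : p.T = q.T)
    (h3 : ∀ α ≤ q.top, ∀ υ < δ, p.f α υ = q.f α υ) (h4 : p.ξ = q.ξ) : RLe p q := by
  refine ⟨⟨h1.ge, ?_, h3⟩, h4, fun υ _ hυ => ?_⟩
  · rw [h2]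
    ext t
    exact ⟨fun h => ⟨h, q.mem_ht t h⟩, fun h => h.1⟩
  · rw [h1, h3 _ le_rfl υ hυ]
    exact BNode.le_rfl' _

open Cardinal in
theorem r_tree_equiv {κ δ : Cardinal.{u}} (hκ : κ.IsInaccessible) (hδ : δ.IsRegular)
    (hδκ : δ < κ) :
    ForcingEquiv (TreeLe (K := Set.Iio κ.ord)) (RLe (κ := κ.ord) (δ := δ.ord)) := by
  classical
  have hinf : ℵ₀ ≤ Cardinal.lift.{u + 1} κ := hκ.isRegular.lift.aleph0_le
  have hδ0 : 0 < δ.ord := hδ.ord_pos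
  have hκ0 : 0 < κ.ord := hκ.isRegular.ord_pos
  have hδκ' : δ.ord < κ.ord := Cardinal.ord_lt_ord.2 hδκ
  have hne : Nonempty (RCond.{u} κ.ord δ.ord) := by
    have no : ∀ α : Ordinal.{u}, ¬ α < 0 := fun α => not_lt.2 zero_le
    obtain ⟨p, -⟩ := add_level (κ := κ.ord) (δ := δ.ord) 0 (succ_lt_ord hκ hκ0) ∅
      (fun _ _ => BNode.cut 0 (fun _ => false)) {BNode.cut 0 (fun _ => false)}
      (fun _ => BNode.cut 0 (fun _ => false)) (by simp) (fun α h => absurd h (no α)) (by simp)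
      (by simp) (by simp) (fun α h => absurd h (no α)) (fun α β _ h => absurd h (no β))
      ⟨_, rfl⟩ (by rintro _ rfl; exact ⟨rfl, fun α h => absurd h (no α)⟩) (fun _ _ => rfl)
      (fun α h => absurd h (no α))
    exact ⟨⟨p, 0, hδ0⟩⟩
  have htop : ∀ p : RCond.{u} κ.ord δ.ord, p.top < κ.ord := fun p =>
    (ord_lt_succ _).trans p.top_lt
  let Y : Set.Iio κ.ord → Type (u + 1) := fun α =>
    {t : BNode.{u} // t.1 ≤ α.1} ⊕
      ((Set.Iio (α.1 + 1) × Set.Iio δ.ord × {t : BNode.{u} // t.1 ≤ α.1}) ⊕ Set.Iio δ.ord)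
  let A1 : (Σ α, Set (Y α)) → BNode.{u} → Prop := fun c t =>
    ∃ h : t.1 ≤ c.1.1, (Sum.inl ⟨t, h⟩ : Y c.1) ∈ c.2
  let A2 : (Σ α, Set (Y α)) → Ordinal.{u} → Ordinal.{u} → BNode.{u} → Prop := fun c α υ t =>
    ∃ (hα : α < c.1.1 + 1) (hυ : υ < δ.ord) (h : t.1 ≤ c.1.1),
      (Sum.inr (Sum.inl (⟨α, hα⟩, ⟨υ, hυ⟩, ⟨t, h⟩)) : Y c.1) ∈ c.2
  let A3 : (Σ α, Set (Y α)) → Ordinal.{u} → Prop := fun c x =>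
    ∃ h : x < δ.ord, (Sum.inr (Sum.inr ⟨x, h⟩) : Y c.1) ∈ c.2
  let code : RCond.{u} κ.ord δ.ord → Σ α, Set (Y α) := fun p =>
    ⟨⟨p.top, htop p⟩, {y | Sum.elim (fun t => t.1 ∈ p.T)
      (Sum.elim (fun z => p.f z.1.1 z.2.1.1 = z.2.2.1) (fun x => x.1 = p.ξ)) y}⟩
  obtain ⟨d, hd⟩ := dense_index hκ (RLe (κ := κ.ord) (δ := δ.ord)) hne Y
    (by
      rintro ⟨α, hα⟩
      have h1 := mk_Iio_lt (succ_lt_ord hκ hα)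
      have h2 := mk_nodes_lt hκ hα
      have h3 := mk_Iio_lt hδκ'
      simp only [Y, Cardinal.mk_sum, Cardinal.mk_prod, Cardinal.lift_id]
      exact Cardinal.add_lt_of_lt hinf h2 (Cardinal.add_lt_of_lt hinf
        (Cardinal.mul_lt_of_lt hinf h1 (Cardinal.mul_lt_of_lt hinf h3 h2)) h3))
    code
    (by
      intro p q h
      have hA1 : ∀ r t, A1 (code r) t ↔ t ∈ r.T := fun r t =>
        ⟨fun ⟨_, h⟩ => h, fun h => ⟨Order.lt_add_one_iff.1 (r.mem_ht t h), h⟩⟩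
      have hA2 : ∀ r : RCond.{u} κ.ord δ.ord, ∀ α ≤ r.top, ∀ υ < δ.ord, ∀ t,
          A2 (code r) α υ t ↔ r.f α υ = t := by
        intro r α hα υ hυ t
        refine ⟨fun ⟨_, _, _, h⟩ => h, fun h => ⟨Order.lt_add_one_iff.2 hα, hυ, ?_, h⟩⟩
        rw [← h]
        exact (r.f_mem α (Order.lt_add_one_iff.2 hα) υ hυ).2.trans_le hα
      have hA3 : ∀ r x, A3 (code r) x ↔ x = r.ξ := fun r x =>
        ⟨fun ⟨_, h⟩ => h, fun h => ⟨h ▸ r.ξ_lt, h⟩⟩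
      have h1 : p.top = q.top := congrArg (fun c : Σ α, Set (Y α) => c.1.1) h
      refine RLe.of_eq h1 ?_ ?_ ?_
      · ext t
        rw [← hA1, ← hA1, h]
      · intro α hα υ hυ
        rw [← hA2 p α (hα.trans_eq h1.symm) υ hυ, h, hA2 q α hα υ hυ]
      · rw [← hA3, ← h, hA3])
  refine tree_equiv RLe.rfl' (fun a b c => RLe.trans') hne ?_ ?_ d hd
  · intro l i f hl hf
    by_cases hi : ∃ j, j < i
    · obtain ⟨j0, hj0⟩ := hi
      let g : Set.Iio i.1 → RCond.{u} κ.ord δ.ord := fun j =>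
        f ⟨j.1, lt_trans (Set.mem_Iio.1 j.2) i.2⟩
      obtain ⟨γ, hγ, h1, h2⟩ := exists_sup_lt hκ (mk_Iio_lt i.2) (fun j => (g j).top)
        (fun j => htop _)
      obtain ⟨m, hm⟩ := limit_ext ⟨⟨j0.1, hj0⟩⟩ g (fun a b => by
        rcases le_total a b with h | h
        · exact Or.inr (hf _ _ h b.2)
        · exact Or.inl (hf _ _ h a.2)) γ (succ_lt_ord hκ hγ) h1 h2
      exact ⟨m, (hm ⟨j0.1, hj0⟩).trans' (hl j0 hj0), fun j hj => hm ⟨j.1, hj⟩⟩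
    · exact ⟨l, RLe.rfl' l, fun j hj => absurd ⟨j, hj⟩ hi⟩
  · intro p
    have mk := fun c => succ_ext hδ0 p.toQCond (succ_lt_ord hκ p.top_lt) (fun υ => p.f p.top υ)
      (fun υ hυ => p.f_mem p.top (ord_lt_succ _) υ hυ) (by
        intro α hα
        rcases (Order.lt_add_one_iff.1 hα).lt_or_eq with h | rfl
        · obtain ⟨ξ, hξ, h⟩ := p.f_ascent α p.top h (ord_lt_succ _)
          exact ⟨ξ, hξ, fun υ h1 h2 => (h υ h1 h2).1⟩
        · exact ⟨0, hδ0, fun _ _ _ => BNode.le_rfl' _⟩) c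
    obtain ⟨a, ha1, ha2, ha3, -, ha4⟩ := mk true
    obtain ⟨b, hb1, hb2, hb3, hb4, -⟩ := mk false
    refine ⟨⟨a, p.ξ, p.ξ_lt⟩, ⟨b, p.ξ, p.ξ_lt⟩, ⟨ha2, rfl, fun υ _ h => ha3 υ h⟩,
      ⟨hb2, rfl, fun υ _ h => hb3 υ h⟩, fun r hra hrb => ?_⟩
    obtain ⟨t, ht, ht1, ht2⟩ := ha4 rfl
    have e1 : a.T = {t ∈ r.T | BNode.ht t < a.top + 1} := hra.1.2.1
    have e2 : b.T = {t ∈ r.T | BNode.ht t < b.top + 1} := hrb.1.2.1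
    have hab : a.T = b.T := by rw [e1, e2, ha1, hb1]
    rw [hab] at ht
    rw [hb4 rfl t ht ht1] at ht2
    cases ht2

/-- The embedding of `R₀` into the iteration. -/
def toIt {κ δ : Ordinal.{u}} (p : RCond.{u} κ δ) : ItCond.{u} κ δ where
  q := p.toQCond
  N := fun α ξ => {r | QLe r p.toQCond ∧ α = p.top ∧ ξ = p.ξ}
  coherent := by
    rintro α ξ r ⟨h1, rfl, rfl⟩
    exact ⟨h1, h1.1, p.ξ_lt⟩
  down_closed := by
    rintro α ξ r ⟨h1, h2⟩ r' h
    exact ⟨h.trans' h1, h2⟩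
  value_unique := by
    rintro α₁ ξ₁ α₂ ξ₂ r ⟨-, rfl, rfl⟩ ⟨-, rfl, rfl⟩
    exact ⟨rfl, rfl⟩
  densely_decided := fun r hr => ⟨r, QLe.rfl' r, p.top, p.ξ, hr, rfl, rfl⟩

theorem ItLe.rfl' {κ δ : Ordinal.{u}} (p : ItCond.{u} κ δ) : ItLe p p := by
  refine ⟨QLe.rfl' _, ?_⟩
  intro r _ α₁ ξ₁ α₂ ξ₂ h1 h2
  obtain ⟨rfl, rfl⟩ := p.value_unique _ _ _ _ r h1 h2
  exact ⟨rfl, fun _ _ _ => BNode.le_rfl' _⟩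

theorem ItLe.trans' {κ δ : Ordinal.{u}} {p q s : ItCond.{u} κ δ} (h1 : ItLe p q)
    (h2 : ItLe q s) : ItLe p s := by
  refine ⟨h1.1.trans' h2.1, ?_⟩
  intro r hr α₁ ξ₁ α₂ ξ₂ hp hs
  obtain ⟨r', hr', α, ξ, hq⟩ := q.densely_decided r (hr.trans' h1.1)
  have hp' := p.down_closed _ _ r hp r' hr'
  have hs' := s.down_closed _ _ r hs r' hr'
  obtain ⟨rfl, k1⟩ := h1.2 r' (hr'.trans' hr) _ _ _ _ hp' hq
  obtain ⟨rfl, k2⟩ := h2.2 r' (hr'.trans' (hr.trans' h1.1)) _ _ _ _ hq hs'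
  refine ⟨rfl, fun υ h3 h4 => ?_⟩
  rw [← hr'.2.2 α₁ (p.coherent _ _ r hp).2.1 υ h4, ← hr'.2.2 α₂ (s.coherent _ _ r hs).2.1 υ h4]
  exact BNode.le_trans' (k2 υ h3 h4) (k1 υ h3 h4)

theorem toIt_le_iff {κ δ : Ordinal.{u}} (p q : RCond.{u} κ δ) :
    ItLe (toIt p) (toIt q) ↔ RLe p q := by
  constructor
  · intro h
    have hq : QLe p.toQCond q.toQCond := h.1
    obtain ⟨k1, k2⟩ := h.2 p.toQCond (QLe.rfl' _) p.top p.ξ q.top q.ξ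
      ⟨QLe.rfl' _, rfl, rfl⟩ ⟨hq, rfl, rfl⟩
    refine ⟨hq, k1, fun υ h1 h2 => ?_⟩
    rw [← hq.2.2 q.top le_rfl υ h2]
    exact k2 υ h1 h2
  · intro h
    refine ⟨h.1, ?_⟩
    rintro r hr α₁ ξ₁ α₂ ξ₂ ⟨h1, rfl, rfl⟩ ⟨h2, rfl, rfl⟩
    refine ⟨h.2.1, fun υ h3 h4 => ?_⟩
    rw [h1.2.2 p.top le_rfl υ h4, h2.2.2 q.top le_rfl υ h4]
    exact h.2.2 υ h3 h4

theorem r_it_equiv {κ δ : Cardinal.{u}} (hκ : κ.IsInaccessible) (hδ : δ.IsRegular) :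
    ForcingEquiv (RLe (κ := κ.ord) (δ := δ.ord)) (ItLe (κ := κ.ord) (δ := δ.ord)) := by
  classical
  have hδ0 : 0 < δ.ord := hδ.ord_pos
  have dense : ∀ p : ItCond.{u} κ.ord δ.ord, ∃ d, ItLe (toIt d) p := by
    intro p
    obtain ⟨r, hr, α, ξ, hN⟩ := p.densely_decided p.q (QLe.rfl' _)
    obtain ⟨-, hα, hξ⟩ := p.coherent _ _ r hN
    have hα' : α < r.top + 1 := Order.lt_add_one_iff.2 hα
    have hg : ∀ υ, ∃ g : BNode.{u}, υ < δ.ord → (g ∈ r.T ∧ g.1 = r.top) ∧ BNode.le (r.f α υ) g ∧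
        (BNode.le (r.f α υ) (r.f r.top υ) → g = r.f r.top υ) := by
      intro υ
      by_cases hυ : υ < δ.ord
      · by_cases h : BNode.le (r.f α υ) (r.f r.top υ)
        · exact ⟨r.f r.top υ, fun _ => ⟨r.f_mem _ (ord_lt_succ _) υ hυ, h, fun _ => rfl⟩⟩
        · obtain ⟨h1, h2⟩ := r.f_mem α hα' υ hυ
          obtain ⟨s, hs, hs1, hs2⟩ := r.normal _ h1 r.top (h2.trans_le hα) (ord_lt_succ _)
          exact ⟨s, fun _ => ⟨⟨hs, hs1⟩, hs2, fun h' => absurd h' h⟩⟩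
      · exact ⟨r.f 0 0, fun h => absurd h hυ⟩
    choose g hg using hg
    have hasc : ∀ β < r.top + 1, ∃ ξ < δ.ord, ∀ υ, ξ ≤ υ → υ < δ.ord →
        BNode.le (r.f β υ) (r.f r.top υ) := by
      intro β hβ
      rcases (Order.lt_add_one_iff.1 hβ).lt_or_eq with h | rfl
      · obtain ⟨ξ, hξ, h⟩ := r.f_ascent β r.top h (ord_lt_succ _)
        exact ⟨ξ, hξ, fun υ h1 h2 => (h υ h1 h2).1⟩
      · exact ⟨0, hδ0, fun _ _ _ => BNode.le_rfl' _⟩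
    obtain ⟨r', h1, h2, h3, -⟩ := succ_ext hδ0 r (succ_lt_ord hκ r.top_lt) g
      (fun υ hυ => (hg υ hυ).1) (by
        intro β hβ
        obtain ⟨ξ1, hξ1, k1⟩ := hasc β hβ
        obtain ⟨ξ2, hξ2, k2⟩ := hasc α hα'
        refine ⟨max ξ1 ξ2, max_lt hξ1 hξ2, fun υ h1 h2 => ?_⟩
        rw [(hg υ h2).2.2 (k2 υ ((le_max_right _ _).trans h1) h2)]
        exact k1 υ ((le_max_left _ _).trans h1) h2) true
    refine ⟨⟨r', ξ, hξ⟩, h2.trans' hr, ?_⟩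
    rintro s hs α₁ ξ₁ α₂ ξ₂ ⟨-, rfl, rfl⟩ hs2
    have hs' : QLe s r' := hs
    have hs3 := p.down_closed _ _ r hN s (hs'.trans' h2)
    obtain ⟨rfl, rfl⟩ := p.value_unique _ _ _ _ s hs2 hs3
    refine ⟨rfl, fun υ _ hυ => ?_⟩
    change BNode.le (s.f α₂ υ) (s.f r'.top υ)
    rw [(hs'.trans' h2).2.2 α₂ hα υ hυ, hs'.2.2 r'.top le_rfl υ hυ]
    exact BNode.le_trans' (hg υ hυ).2.1 (h3 υ hυ)
  refine forcingEquiv_of_dense RLe.rfl' (fun a b c => RLe.trans') ItLe.rfl'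
    (fun a b c => ItLe.trans') toIt (fun a b => (toIt_le_iff a b).2) ?_ dense
  intro a b p h1 h2
  obtain ⟨d, hd⟩ := dense p
  exact ⟨d, (toIt_le_iff _ _).1 (hd.trans' h1), (toIt_le_iff _ _).1 (hd.trans' h2)⟩


/-- If `κ` is 2-Mahlo, `δ < κ` is regular and `2^{<κ} = κ`, then the two-step iteration
`Q_{κ,δ} * Ḟ_{κ,δ}` is forcing equivalent to the Cohen forcing `Add(κ,1)` (it has a
`<κ`-closed dense subset of size `κ`, and every `<κ`-closed separative poset of size `κ`
is forcing equivalent to `Add(κ,1)`). -/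
theorem iteration_equiv_add (κ δ : Cardinal.{u})
    (h2M : Is2Mahlo κ) (hδ : δ.IsRegular) (hδκ : δ < κ)
    (hcont : ∀ μ < κ, (2 : Cardinal.{u}) ^ μ ≤ κ) :
    ForcingEquiv (ItLe (κ := κ.ord) (δ := δ.ord)) (AddLe (κ := κ.ord)) := by
  have hκ : κ.IsInaccessible := h2M.1.1
  exact ((r_it_equiv hκ hδ).symm'.trans' (r_tree_equiv hκ hδ hδκ).symm').trans'
    (add_tree_equiv hκ)
end
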